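/- arXiv:2403.19503 — 11 statements merged into one kernel-verified Lean document; each statement's English description precedes it below -/
import Mathlib

section
/- For any prime $p \ge 5$, $\sum_{j=1}^{p-1} \frac{1}{j^2} \equiv \frac{2}{3} p B_{p-3} \pmod{p^2}$ (as a congruence of rational numbers, i.e. the $p$-adic valuation of the difference is at least $2$). -/
open Finset

theorem sum_range_two_mul_succ_reflect {M : Type*} [AddCommMonoid M] (f : ℕ → M) (h : ℕ) :
    ∑ j ∈ range (2 * h), f (j + 1) =
      ∑ i ∈ range h, (f (i + 1) + f (2 * h + 1 - (i + 1))) := by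
  rw [two_mul, sum_range_add, sum_add_distrib, ← sum_range_reflect (fun i => f (h + i + 1))]
  congr 1
  refine sum_congr rfl fun i hi => ?_
  rw [mem_range] at hi
  congr 1
  omega

theorem sum_range_two_mul_succ_parity {M : Type*} [AddCommMonoid M] (f : ℕ → M) (h : ℕ) :
    ∑ j ∈ range (2 * h), f (j + 1) =
      ∑ i ∈ range h, (f (2 * (i + 1)) + f (2 * h + 1 - 2 * (i + 1))) := by
  have key : ∀ n, ∑ j ∈ range (2 * n), f (j + 1) =
      ∑ i ∈ range n, f (2 * (i + 1)) + ∑ i ∈ range n, f (2 * i + 1) := by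
    intro n
    induction n with
    | zero => simp
    | succ n ih =>
      rw [mul_add_one, sum_range_succ, sum_range_succ, ih, sum_range_succ, sum_range_succ,
        mul_add_one]
      abel
  rw [key, sum_add_distrib, ← sum_range_reflect (fun i => f (2 * i + 1))]
  congr 1
  refine sum_congr rfl fun i hi => ?_
  rw [mem_range] at hi
  congr 1
  omega

theorem dvd_sub_pow_sub {k : ℕ} (hk : Even k) (x y : ℤ) :
    y ^ 2 ∣ (y - x) ^ k - (x ^ k - k * y * x ^ (k - 1)) := by
  obtain rfl | hk0 := Nat.eq_zero_or_pos k
  · simp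
  obtain ⟨c, hc⟩ := Polynomial.powAddExpansion (-x) y k
  have hodd : Odd (k - 1) := Nat.Even.sub_odd hk0 hk odd_one
  rw [hk.neg_pow, hodd.neg_pow] at hc
  refine ⟨c, ?_⟩
  rw [sub_eq_neg_add y x, hc]
  ring

/-- Comparing the sum of even powers over `1, …, 2h` with its dilation by `2`. -/
theorem sq_dvd_two_pow_sub_one_mul_sum_pow {k : ℕ} (hk : Even k) (hk0 : 0 < k) (h : ℕ) :
    ((2 * h + 1 : ℕ) : ℤ) ^ 2 ∣ (2 ^ k - 1) * ∑ j ∈ range (2 * h), ((j + 1 : ℕ) : ℤ) ^ k +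
      k * (2 * h + 1 : ℕ) * 2 ^ (k - 1) * ∑ i ∈ range h, ((i + 1 : ℕ) : ℤ) ^ (k - 1) := by
  set P : ℤ := ((2 * h + 1 : ℕ) : ℤ) with hP
  set S := ∑ j ∈ range (2 * h), ((j + 1 : ℕ) : ℤ) ^ k with hS
  set U := ∑ i ∈ range h, ((i + 1 : ℕ) : ℤ) ^ (k - 1) with hU
  set V := ∑ i ∈ range h, ((i + 1 : ℕ) : ℤ) ^ k with hV
  have h1 : P ^ 2 ∣ S - (2 * V - k * P * U) := by
    rw [hS, sum_range_two_mul_succ_reflect (fun j => (j : ℤ) ^ k), hV, hU, mul_sum, mul_sum,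
      ← sum_sub_distrib, ← sum_sub_distrib]
    refine dvd_sum fun i hi => ?_
    rw [mem_range] at hi
    rw [Nat.cast_sub (by omega)]
    obtain ⟨c, hc⟩ := dvd_sub_pow_sub hk ((i + 1 : ℕ) : ℤ) P
    exact ⟨c, by linear_combination hc⟩
  have h2 : P ^ 2 ∣ S - (2 * 2 ^ k * V - k * P * 2 ^ (k - 1) * U) := by
    rw [hS, sum_range_two_mul_succ_parity (fun j => (j : ℤ) ^ k), hV, hU, mul_sum, mul_sum,
      ← sum_sub_distrib, ← sum_sub_distrib]
    refine dvd_sum fun i hi => ?_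
    rw [mem_range] at hi
    rw [Nat.cast_sub (by omega)]
    obtain ⟨c, hc⟩ := dvd_sub_pow_sub hk ((2 * (i + 1) : ℕ) : ℤ) P
    rw [← hP]
    simp only [Nat.cast_mul, Nat.cast_ofNat, mul_pow] at hc ⊢
    exact ⟨c, by linear_combination hc⟩
  have h3 : (2 : ℤ) ^ k = 2 * 2 ^ (k - 1) := by
    rw [← pow_succ', Nat.sub_add_cancel hk0]
  obtain ⟨a, ha⟩ := h1
  obtain ⟨b, hb⟩ := h2
  refine ⟨2 ^ k * a - b, ?_⟩
  rw [h3] at hb ⊢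
  linear_combination 2 * 2 ^ (k - 1) * ha - hb

theorem bernoulli'_padicNorm_le_one (p : ℕ) [Fact p.Prime] (n : ℕ) (hn : n + 1 < p) :
    padicNorm p (bernoulli' n) ≤ 1 := by
  induction n using Nat.strong_induction_on with
  | _ n ih =>
    rw [bernoulli'_def]
    refine padicNorm.sub.trans (max_le (by simp) ?_)
    refine padicNorm.sum_le' (fun k hk => ?_) zero_le_one
    rw [mem_range] at hk
    have hd : padicNorm p ((n : ℚ) - k + 1) = 1 := by
      have : ((n : ℚ) - k + 1) = ((n - k + 1 : ℕ) : ℚ) := by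
        push_cast [Nat.cast_sub hk.le]; ring
      rw [this, padicNorm.nat_eq_one_iff]
      exact Nat.not_dvd_of_pos_of_lt (by omega) (by omega)
    rw [padicNorm.mul, padicNorm.div, hd, div_one]
    exact mul_le_one₀ (padicNorm.of_nat _) (padicNorm.nonneg _) (ih k hk (by omega))

theorem bernoulli_padicNorm_le_one (p : ℕ) [Fact p.Prime] (n : ℕ) (hn : n + 1 < p) :
    padicNorm p (bernoulli n) ≤ 1 := by
  rw [bernoulli, padicNorm.mul]
  refine mul_le_one₀ ?_ (padicNorm.nonneg _) (bernoulli'_padicNorm_le_one p n hn)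
  exact_mod_cast padicNorm.of_int (p := p) ((-1) ^ n)

/-- The sum of `k`-th powers below `p` is `p * bernoulli k` modulo `p ^ 2`, for `k < p - 1`. -/
theorem padicNorm_sum_range_pow_sub_le (p : ℕ) [hp : Fact p.Prime] (k : ℕ) (hk : k + 1 < p) :
    padicNorm p (∑ j ∈ range p, (j : ℚ) ^ k - p * bernoulli k) ≤ (p : ℚ) ^ (-(2 : ℤ)) := by
  have hk1 : ((k : ℚ) + 1) ≠ 0 := by positivity
  have hd : padicNorm p ((k : ℚ) + 1) = 1 := by
    have : ((k : ℚ) + 1) = ((k + 1 : ℕ) : ℚ) := by push_cast; ring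
    rw [this, padicNorm.nat_eq_one_iff]
    exact Nat.not_dvd_of_pos_of_lt (by omega) (by omega)
  have hlast : bernoulli k * ((k + 1).choose k) * (p : ℚ) ^ (k + 1 - k) / (k + 1) =
      p * bernoulli k := by
    rw [Nat.choose_succ_self_right, Nat.add_sub_cancel_left]
    push_cast
    field_simp
  rw [sum_range_pow, sum_range_succ, hlast, add_sub_cancel_right]
  refine padicNorm.sum_le' (fun i hi => ?_) (by positivity)
  rw [mem_range] at hi
  have hpow : padicNorm p ((p : ℚ) ^ (k + 1 - i)) ≤ (p : ℚ) ^ (-(2 : ℤ)) := by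
    have := (padicNorm.dvd_iff_norm_le (p := p) (n := 2) (z := (p : ℤ) ^ (k + 1 - i))).1
      (by exact_mod_cast pow_dvd_pow p (by omega))
    exact_mod_cast this
  rw [padicNorm.div, hd, div_one, padicNorm.mul, padicNorm.mul]
  refine (mul_le_of_le_one_left (padicNorm.nonneg _) ?_).trans hpow
  exact mul_le_one₀ (bernoulli_padicNorm_le_one p i (by omega)) (padicNorm.nonneg _)
    (padicNorm.of_nat _)

theorem modEq_pow_add_mul_sub_one {p : ℕ} (hp : p.Prime) {a : ℤ} (ha : IsCoprime a p) (n m : ℕ) :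
    a ^ (n + (p - 1) * m) ≡ a ^ n [ZMOD p] := by
  have := (Int.ModEq.pow_card_sub_one_eq_one hp ha).pow m
  rw [pow_add, pow_mul]
  simpa using this.mul_left (a ^ n)

theorem isCoprime_natCast_of_lt {p j : ℕ} (hp : p.Prime) (hj : 0 < j) (hjp : j < p) :
    IsCoprime (j : ℤ) p :=
  Nat.isCoprime_iff_coprime.2 (Nat.coprime_of_lt_prime hj.ne' hjp hp).symm

/-- For `p ≥ 5` prime, `3 ∑ j ^ (p (p - 1) - 2) ≡ 2 ∑ j ^ (p - 3)` modulo `p ^ 2`. -/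
theorem sq_dvd_three_mul_sum_pow_sub (p : ℕ) (hp : p.Prime) (hp5 : 5 ≤ p) :
    (p : ℤ) ^ 2 ∣ 3 * ∑ j ∈ range (p - 1), ((j + 1 : ℕ) : ℤ) ^ (p * (p - 1) - 2) -
      2 * ∑ j ∈ range (p - 1), ((j + 1 : ℕ) : ℤ) ^ (p - 3) := by
  obtain ⟨h, rfl⟩ := hp.odd_of_ne_two (by omega)
  set p := 2 * h + 1 with hph
  have hexp : p * (p - 1) - 2 = p - 3 + (p - 1) * (p - 1) := by
    obtain ⟨q, rfl⟩ : ∃ q, h = q + 2 := ⟨h - 2, by omega⟩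
    have e1 : p = 2 * q + 5 := by omega
    have e2 : p - 1 = 2 * q + 4 := by omega
    have e3 : p - 3 = 2 * q + 2 := by omega
    rw [e2, e3, e1]
    have : (2 * q + 5) * (2 * q + 4) = (2 * q + 4) * (2 * q + 4) + (2 * q + 4) := by ring
    omega
  have hexp' : p * (p - 1) - 2 - 1 = p - 3 - 1 + (p - 1) * (p - 1) := by omega
  set k := p - 3 with hk
  set l := p * (p - 1) - 2 with hl
  have hkE : Even k := ⟨h - 1, by omega⟩
  have hlE : Even l := by
    rw [hexp]
    exact hkE.add (Even.mul_right ⟨h, by omega⟩ _)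
  have hp1 : p - 1 = 2 * h := by omega
  rw [hp1]
  have A := sq_dvd_two_pow_sub_one_mul_sum_pow hkE (by omega) h
  have B := sq_dvd_two_pow_sub_one_mul_sum_pow hlE (by omega) h
  rw [← hph] at A B
  set Sk := ∑ j ∈ range (2 * h), ((j + 1 : ℕ) : ℤ) ^ k
  set Sl := ∑ j ∈ range (2 * h), ((j + 1 : ℕ) : ℤ) ^ l
  set Uk := ∑ i ∈ range h, ((i + 1 : ℕ) : ℤ) ^ (k - 1)
  set Ul := ∑ i ∈ range h, ((i + 1 : ℕ) : ℤ) ^ (l - 1)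
  have c2 : IsCoprime (2 : ℤ) p := by
    exact_mod_cast isCoprime_natCast_of_lt hp (j := 2) (by omega) (by omega)
  have c3 : IsCoprime (3 : ℤ) p := by
    exact_mod_cast isCoprime_natCast_of_lt hp (j := 3) (by omega) (by omega)
  have hU : Ul ≡ Uk [ZMOD p] := by
    refine Int.ModEq.sum fun i hi => ?_
    rw [mem_range] at hi
    rw [hexp']
    exact modEq_pow_add_mul_sub_one hp
      (isCoprime_natCast_of_lt hp (by omega) (by omega)) _ _
  have h2 : (2 : ℤ) ^ (l - 1) ≡ 2 ^ (k - 1) [ZMOD p] := by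
    rw [hexp']
    exact modEq_pow_add_mul_sub_one hp c2 _ _
  have h4k : (4 : ℤ) * 2 ^ k ≡ 1 [ZMOD p] := by
    have := modEq_pow_add_mul_sub_one hp c2 0 1
    have e : 0 + (p - 1) * 1 = 2 + k := by omega
    rw [e, pow_add] at this
    norm_num at this
    exact this
  have h4l : (4 : ℤ) * 2 ^ l ≡ 1 [ZMOD p] := by
    refine Int.ModEq.trans ?_ h4k
    rw [hexp]
    exact (modEq_pow_add_mul_sub_one hp c2 _ _).mul_left 4
  have dvd_of : ∀ (m : ℕ) (S W : ℤ), (4 : ℤ) * 2 ^ m ≡ 1 [ZMOD p] →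
      (p : ℤ) ^ 2 ∣ (2 ^ m - 1) * S + p * W → (p : ℤ) ^ 2 ∣ 3 * S - 4 * p * W := by
    intro m S W hm hd
    obtain ⟨c, hc⟩ := hm.symm.dvd
    obtain ⟨d, hd⟩ := hd
    have hS : (p : ℤ) ∣ S := by
      refine c3.symm.dvd_of_dvd_mul_left ⟨c * S + 4 * W - 4 * p * d, ?_⟩
      linear_combination (-4) * hd + S * hc
    obtain ⟨s, rfl⟩ := hS
    exact ⟨c * s - 4 * d, by linear_combination p * s * hc - 4 * hd⟩
  have A' := dvd_of k Sk (k * 2 ^ (k - 1) * Uk) h4k (by convert A using 2; ring)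
  have B' := dvd_of l Sl (l * 2 ^ (l - 1) * Ul) h4l (by convert B using 2; ring)
  have hW : (3 : ℤ) * (l * 2 ^ (l - 1) * Ul) ≡ 2 * (k * 2 ^ (k - 1) * Uk) [ZMOD p] := by
    have ek : (k : ℤ) ≡ -3 [ZMOD p] := by
      have : (k : ℤ) = p - 3 := by omega
      rw [this]
      exact (Int.modEq_iff_dvd.2 ⟨-1, by ring⟩)
    have el : (l : ℤ) ≡ -2 [ZMOD p] := by
      have : (l : ℤ) = p * (p - 1 : ℕ) - 2 := by
        rw [hl, Nat.cast_sub (by nlinarith [Nat.sub_add_cancel hp.one_le])]; push_cast; ring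
      rw [this]
      exact (Int.modEq_iff_dvd.2 ⟨-(p - 1 : ℕ), by ring⟩)
    have e1 := ((el.mul h2).mul hU).mul_left 3
    have e2 := ((ek.mul_right (2 ^ (k - 1))).mul_right Uk).mul_left 2
    refine e1.trans (Int.ModEq.trans ?_ e2.symm)
    rw [show (3 : ℤ) * (-2 * 2 ^ (k - 1) * Uk) = 2 * (-3 * 2 ^ (k - 1) * Uk) by ring]
  obtain ⟨w, hw⟩ := hW.symm.dvd
  obtain ⟨a, ha⟩ := A'
  obtain ⟨b, hb⟩ := B'
  refine (IsCoprime.pow_right c3 (n := 2)).symm.dvd_of_dvd_mul_left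
    ⟨3 * b - 2 * a + 4 * w, ?_⟩
  linear_combination 3 * hb - 2 * ha + 4 * p * hw

theorem sum_inv_sq_congr (p : ℕ) (hp : p.Prime) (hp5 : 5 ≤ p) :
    padicNorm p ((∑ j ∈ Icc 1 (p - 1), 1 / (j : ℚ) ^ 2) - (2 / 3) * p * bernoulli (p - 3)) ≤
      (p : ℚ) ^ (-(2 : ℤ)) := by
  have : Fact p.Prime := ⟨hp⟩
  have natnorm : ∀ j : ℕ, 0 < j → j < p → padicNorm p (j : ℚ) = 1 := fun j h0 hj =>
    (padicNorm.nat_eq_one_iff j).2 (Nat.not_dvd_of_pos_of_lt h0 hj)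
  have n2 : padicNorm p 2 = 1 := by exact_mod_cast natnorm 2 (by omega) (by omega)
  have n3 : padicNorm p 3 = 1 := by exact_mod_cast natnorm 3 (by omega) (by omega)
  set l := p * (p - 1) - 2 with hl
  have hl2 : l + 2 = p * (p - 1) :=
    Nat.sub_add_cancel (by nlinarith [Nat.sub_add_cancel hp.one_le])
  have hIcc : Icc 1 (p - 1) = Ico 1 p := by ext; simp; omega
  have h1 : padicNorm p (∑ j ∈ Icc 1 (p - 1), (1 / (j : ℚ) ^ 2 - (j : ℚ) ^ l)) ≤
      (p : ℚ) ^ (-(2 : ℤ)) := by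
    refine padicNorm.sum_le' (fun j hj => ?_) (by positivity)
    rw [mem_Icc] at hj
    have hj0 : (j : ℚ) ≠ 0 := Nat.cast_ne_zero.2 (by omega)
    have e : 1 / (j : ℚ) ^ 2 - (j : ℚ) ^ l =
        ((1 - (j : ℤ) ^ (p * (p - 1)) : ℤ) : ℚ) / (j : ℚ) ^ 2 := by
      rw [← hl2, pow_add]
      push_cast
      field_simp
    have hn : padicNorm p ((j : ℚ) ^ 2) = 1 := by
      rw [sq, padicNorm.mul, natnorm j (by omega) (by omega), one_mul]
    rw [e, padicNorm.div, hn, div_one]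
    refine (padicNorm.dvd_iff_norm_le (n := 2)).1 ?_
    have hc : Nat.Coprime j (p ^ 2) :=
      (Nat.coprime_of_lt_prime (by omega) (by omega) hp).symm.pow_right 2
    have := Nat.ModEq.pow_totient hc
    rw [Nat.totient_prime_pow hp (by norm_num)] at this
    have := (Int.natCast_modEq_iff.2 this).dvd
    simpa using this
  have h2 : padicNorm p (∑ j ∈ Icc 1 (p - 1), (j : ℚ) ^ l -
      2 / 3 * ∑ j ∈ Icc 1 (p - 1), (j : ℚ) ^ (p - 3)) ≤ (p : ℚ) ^ (-(2 : ℤ)) := by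
    have := (padicNorm.dvd_iff_norm_le (p := p) (n := 2)).1
      (by simpa only [Nat.cast_pow] using sq_dvd_three_mul_sum_pow_sub p hp hp5)
    rw [← one_mul (padicNorm p _), ← n3, ← padicNorm.mul]
    refine (congrArg (padicNorm p) ?_).trans_le this
    rw [hIcc, sum_Ico_eq_sum_range, sum_Ico_eq_sum_range]
    push_cast
    simp only [add_comm (1 : ℚ)]
    ring
  have h3 : padicNorm p (2 / 3 * (∑ j ∈ Icc 1 (p - 1), (j : ℚ) ^ (p - 3) -
      p * bernoulli (p - 3))) ≤ (p : ℚ) ^ (-(2 : ℤ)) := by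
    rw [padicNorm.mul, padicNorm.div, n2, n3, div_one, one_mul]
    convert padicNorm_sum_range_pow_sub_le p (p - 3) (by omega) using 3
    rw [hIcc, range_eq_Ico, sum_eq_sum_Ico_succ_bot hp.pos]
    simp [show p - 3 ≠ 0 by omega]
  rw [sum_sub_distrib] at h1
  have h := padicNorm.nonarchimedean.trans
    (max_le (padicNorm.nonarchimedean.trans (max_le h1 h2)) h3)
  rwa [sub_add_sub_cancel, mul_sub, sub_add_sub_cancel, ← mul_assoc] at h
end

section
/- For any prime $p \ge 5$, $\sum_{j=1}^{(p-1)/2} \frac{1}{j^2} \equiv \frac{7}{3} p B_{p-3} \pmod{p^2}$ (as a congruence of rational numbers, i.e. the $p$-adic valuation of the difference is at least $2$). -/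
open Finset

/-- The subring of `ℚ` of rational numbers that are integral at the prime `p`. -/
def padicIntegralRat (p : ℕ) [Fact p.Prime] : Subring ℚ where
  carrier := {x | padicNorm p x ≤ 1}
  zero_mem' := by simp
  one_mem' := by simp
  add_mem' hx hy := padicNorm.nonarchimedean.trans (max_le hx hy)
  neg_mem' {x} hx := (padicNorm.neg x).trans_le hx
  mul_mem' {x y} hx hy :=
    (padicNorm.mul x y).trans_le (mul_le_one₀ hx (padicNorm.nonneg y) hy)

namespace padicIntegralRat

variable {p : ℕ} [Fact p.Prime]

lemma inv_natCast_mem {k : ℕ} (h0 : 0 < k) (hk : k < p) : (k : ℚ)⁻¹ ∈ padicIntegralRat p := by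
  have h : padicNorm p (k : ℚ) = 1 :=
    (padicNorm.nat_eq_one_iff k).2 (Nat.not_dvd_of_pos_of_lt h0 hk)
  change padicNorm p (k : ℚ)⁻¹ ≤ 1
  rw [← one_div, padicNorm.div, h]
  simp

lemma padicNorm_pow_mul_le {a : ℚ} (ha : a ∈ padicIntegralRat p) (m : ℕ) :
    padicNorm p ((p : ℚ) ^ m * a) ≤ (p : ℚ) ^ (-(m : ℤ)) := by
  have h : padicNorm p ((p : ℚ) ^ m) ≤ (p : ℚ) ^ (-(m : ℤ)) := by
    have := (padicNorm.dvd_iff_norm_le (p := p) (n := m) (z := (p : ℤ) ^ m)).1 (by simp)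
    exact_mod_cast this
  rw [padicNorm.mul]
  exact (mul_le_of_le_one_right (padicNorm.nonneg _) ha).trans h

lemma bernoulli_mem {n : ℕ} (hn : n + 1 < p) : bernoulli n ∈ padicIntegralRat p := by
  suffices h : bernoulli' n ∈ padicIntegralRat p from
    mul_mem (pow_mem (neg_mem (one_mem _)) n) h
  induction n using Nat.strong_induction_on with
  | _ n ih =>
    rw [bernoulli'_def]
    refine sub_mem (one_mem _) (sum_mem fun k hk => ?_)
    have hk := mem_range.1 hk
    have hcast : (n : ℚ) - k + 1 = ((n - k + 1 : ℕ) : ℚ) := by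
      push_cast [Nat.cast_sub hk.le]; rfl
    rw [hcast, div_eq_mul_inv]
    exact mul_mem (mul_mem (natCast_mem _ _) (inv_natCast_mem (by omega) (by omega)))
      (ih k hk (by omega))

/-- Faulhaber's formula modulo `p ^ 2`. -/
lemma exists_sum_range_pow_eq {m : ℕ} (hm : m + 1 < p) :
    ∃ a ∈ padicIntegralRat p,
      ∑ k ∈ range p, (k : ℚ) ^ m = p * bernoulli m + (p : ℚ) ^ 2 * a := by
  refine ⟨∑ i ∈ range m, bernoulli i * ((m + 1).choose i : ℕ) * (p : ℚ) ^ (m - 1 - i) *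
    ((m + 1 : ℕ) : ℚ)⁻¹, sum_mem fun i hi => ?_, ?_⟩
  · have hi := mem_range.1 hi
    exact mul_mem (mul_mem (mul_mem (bernoulli_mem (by omega)) (natCast_mem _ _))
      (pow_mem (natCast_mem _ _) _)) (inv_natCast_mem (by omega) hm)
  · rw [sum_range_pow, sum_range_succ, add_comm, mul_sum]
    congr 1
    · have : (m : ℚ) + 1 ≠ 0 := by positivity
      simp
      field_simp
    · refine sum_congr rfl fun i hi => ?_
      have hi := mem_range.1 hi
      rw [show m + 1 - i = m - 1 - i + 2 by omega, pow_add, div_eq_mul_inv]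
      push_cast
      ring

lemma exists_pow_card_sub_one_eq {k : ℕ} (h0 : 0 < k) (hk : k < p) :
    ∃ a ∈ padicIntegralRat p, (k : ℚ) ^ (p - 1) = 1 + p * a := by
  have h : ((((k : ℤ) ^ (p - 1) - 1 : ℤ)) : ZMod p) = 0 := by
    have : (k : ZMod p) ≠ 0 := by
      rw [Ne, ZMod.natCast_eq_zero_iff]
      exact Nat.not_dvd_of_pos_of_lt h0 hk
    push_cast
    rw [ZMod.pow_card_sub_one_eq_one this, sub_self]
  obtain ⟨c, hc⟩ := (ZMod.intCast_zmod_eq_zero_iff_dvd _ _).1 h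
  refine ⟨c, intCast_mem _ c, ?_⟩
  have hc' : (k : ℚ) ^ (p - 1) - 1 = p * c := by exact_mod_cast hc
  linear_combination hc'

end padicIntegralRat

lemma sum_Icc_two_mul {M : Type*} [AddCommMonoid M] (f : ℕ → M) (n : ℕ) :
    ∑ j ∈ Icc 1 (2 * n), f j = ∑ j ∈ Icc 1 n, (f j + f (2 * n + 1 - j)) := by
  have h : ∑ j ∈ Icc 1 n, f (2 * n + 1 - j) = ∑ j ∈ Ico (n + 1) (2 * n + 1), f j := by
    refine sum_bij' (fun j _ => 2 * n + 1 - j) (fun j _ => 2 * n + 1 - j) ?_ ?_ ?_ ?_ ?_ <;>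
      simp only [mem_Icc, mem_Ico] <;> intros <;> grind
  rw [sum_add_distrib, h, ← Ico_add_one_right_eq_Icc, ← Ico_add_one_right_eq_Icc,
    sum_Ico_consecutive _ (by omega) (by omega)]

lemma sum_Icc_two_mul_even {M : Type*} [AddCommMonoid M] (f : ℕ → M) (n : ℕ) :
    ∑ j ∈ Icc 1 (2 * n), f j = ∑ j ∈ Icc 1 n, (f (2 * j) + f (2 * n + 1 - 2 * j)) := by
  have hodd : ∑ j ∈ Icc 1 n, f (2 * n + 1 - 2 * j) = ∑ j ∈ Icc 1 n, f (2 * j - 1) := by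
    refine sum_bij' (fun j _ => n + 1 - j) (fun j _ => n + 1 - j) ?_ ?_ ?_ ?_ ?_ <;>
      simp only [mem_Icc] <;> intros <;> grind
  rw [sum_add_distrib, hodd, ← sum_add_distrib]
  clear hodd
  induction n with
  | zero => simp
  | succ n ih =>
    rw [show 2 * (n + 1) = 2 * n + 1 + 1 by ring, sum_Icc_succ_top (by omega),
      sum_Icc_succ_top (by omega), sum_Icc_succ_top (by omega), ih, add_assoc]
    congr 1
    rw [add_comm]
    congr 1

/-- If `f` has reflection formula `f (q - j) ≡ f j + q g j` modulo `q ^ 2` with `q = 2 n + 1`, and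
`f`, `g` are homogeneous under doubling, then splitting a full sum of `f` into the two halves or
into the even and odd terms gives two congruences for it. -/
lemma exists_sum_Icc_two_mul_eq (A : Subring ℚ) {n : ℕ} {q c d : ℚ} {f g : ℕ → ℚ}
    (hfg : ∀ j ∈ Icc 1 (2 * n), ∃ a ∈ A, f (2 * n + 1 - j) = f j + q * g j + q ^ 2 * a)
    (hf : ∀ j, f (2 * j) = c * f j) (hg : ∀ j, g (2 * j) = d * g j) :
    ∃ a ∈ A, ∃ b ∈ A,
      ∑ j ∈ Icc 1 (2 * n), f j
        = 2 * ∑ j ∈ Icc 1 n, f j + q * ∑ j ∈ Icc 1 n, g j + q ^ 2 * a ∧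
      ∑ j ∈ Icc 1 (2 * n), f j
        = 2 * c * ∑ j ∈ Icc 1 n, f j + q * d * ∑ j ∈ Icc 1 n, g j + q ^ 2 * b := by
  choose! r hrA hr using hfg
  refine ⟨∑ j ∈ Icc 1 n, r j, sum_mem fun j hj => hrA j ?_,
    ∑ j ∈ Icc 1 n, r (2 * j), sum_mem fun j hj => hrA _ ?_, ?_, ?_⟩
  · rw [mem_Icc] at *; omega
  · rw [mem_Icc] at *; omega
  · rw [sum_Icc_two_mul]
    simp only [mul_sum, ← sum_add_distrib]
    refine sum_congr rfl fun j hj => ?_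
    rw [hr j (by rw [mem_Icc] at *; omega)]
    ring
  · rw [sum_Icc_two_mul_even]
    simp only [mul_sum, ← sum_add_distrib]
    refine sum_congr rfl fun j hj => ?_
    rw [hr _ (by rw [mem_Icc] at *; omega), hf, hg]
    ring

section

variable {p n : ℕ} [Fact p.Prime]

open padicIntegralRat

lemma exists_sum_inv_sq_half_eq (hp5 : 5 ≤ p) (hpn : p = 2 * n + 1) :
    ∃ a ∈ padicIntegralRat p, ∑ j ∈ Icc 1 n, ((j : ℚ) ^ 2)⁻¹
      = -(7 / 6) * p * ∑ j ∈ Icc 1 n, ((j : ℚ) ^ 3)⁻¹ + (p : ℚ) ^ 2 * a := by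
  obtain ⟨a, ha, b, hb, h1, h2⟩ := exists_sum_Icc_two_mul_eq (padicIntegralRat p) (n := n)
    (q := p) (c := 1 / 4) (d := 1 / 8) (f := fun j => ((j : ℚ) ^ 2)⁻¹)
    (g := fun j => 2 * ((j : ℚ) ^ 3)⁻¹)
    (by
      intro j hj
      rw [mem_Icc] at hj
      have hjp : j < p := by omega
      rw [← hpn]
      refine ⟨(3 * j - 2 * p) * ((j : ℚ)⁻¹ ^ 3 * ((p - j : ℕ) : ℚ)⁻¹ ^ 2), ?_, ?_⟩
      · exact mul_mem
          (sub_mem (mul_mem (natCast_mem _ 3) (natCast_mem _ j))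
            (mul_mem (natCast_mem _ 2) (natCast_mem _ p)))
          (mul_mem (pow_mem (inv_natCast_mem (by omega) hjp) _)
            (pow_mem (inv_natCast_mem (by omega) (by omega)) _))
      · have hj0 : (j : ℚ) ≠ 0 := by
          have : j ≠ 0 := by omega
          exact_mod_cast this
        have hpj : (p : ℚ) - j ≠ 0 := by
          have : (j : ℚ) < p := by exact_mod_cast hjp
          linarith
        push_cast [Nat.cast_sub hjp.le]
        field_simp
        ring)
    (by intro j; push_cast; rw [mul_pow, mul_inv]; norm_num)
    (by intro j; push_cast; rw [mul_pow, mul_inv]; ring)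
  have h3 := inv_natCast_mem (p := p) (k := 3) (by omega) (by omega)
  refine ⟨2 * ((3 : ℕ) : ℚ)⁻¹ * (b - a),
    mul_mem (mul_mem (natCast_mem _ 2) h3) (sub_mem hb ha), ?_⟩
  rw [← mul_sum] at h1 h2
  push_cast
  linear_combination (2 / 3) * (h2 - h1)

lemma exists_sum_pow_half_eq (hp5 : 5 ≤ p) (hpn : p = 2 * n + 1) :
    ∃ a ∈ padicIntegralRat p, ∑ j ∈ Icc 1 n, (j : ℚ) ^ (p - 4)
      = -2 * bernoulli (p - 3) + p * a := by
  obtain ⟨m, hm⟩ : ∃ m, p = m + 4 := ⟨p - 4, by omega⟩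
  obtain ⟨a, ha, b, hb, h1, h2⟩ := exists_sum_Icc_two_mul_eq (padicIntegralRat p) (n := n)
    (q := p) (c := 2 ^ (m + 1)) (d := 2 ^ m) (f := fun j => (j : ℚ) ^ (m + 1))
    (g := fun j => -((m + 1 : ℕ) : ℚ) * (j : ℚ) ^ m)
    (by
      intro j hj
      rw [mem_Icc] at hj
      have hjp : j < p := by omega
      rw [← hpn]
      obtain ⟨k, hk⟩ := Polynomial.powAddExpansion (-(j : ℤ)) (p : ℤ) (m + 1)
      have heven : Even (m + 1) := by
        rw [Nat.even_iff]; omega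
      have hodd : Odd m := by
        rw [Nat.odd_iff]; omega
      rw [Nat.add_sub_cancel, heven.neg_pow, hodd.neg_pow] at hk
      have hk' : (-(j : ℚ) + p) ^ (m + 1)
          = (j : ℚ) ^ (m + 1) + (m + 1 : ℕ) * -(j : ℚ) ^ m * p + k * (p : ℚ) ^ 2 := by
        exact_mod_cast hk
      refine ⟨k, intCast_mem _ k, ?_⟩
      rw [Nat.cast_sub hjp.le]
      linear_combination hk')
    (by intro j; push_cast; rw [mul_pow])
    (by intro j; push_cast; rw [mul_pow]; ring)
  obtain ⟨r, hr, hS⟩ := exists_sum_range_pow_eq (p := p) (m := m + 1) (by omega)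
  obtain ⟨e, he, h2pow⟩ := exists_pow_card_sub_one_eq (p := p) (k := 2) (by omega) (by omega)
  have hfull : ∑ k ∈ range p, (k : ℚ) ^ (m + 1) = ∑ k ∈ Icc 1 (2 * n), (k : ℚ) ^ (m + 1) := by
    rw [range_eq_Ico, sum_eq_sum_Ico_succ_bot (by omega), ← Ico_add_one_right_eq_Icc, ← hpn]
    simp
  have h3 := inv_natCast_mem (p := p) (k := 3) (by omega) (by omega)
  rw [← hfull, hS, ← mul_sum] at h1 h2
  rw [show p - 4 = m by omega, show p - 3 = m + 1 by omega]
  have hB : bernoulli (m + 1) ∈ padicIntegralRat p := bernoulli_mem (by omega)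
  have hT : ∑ j ∈ Icc 1 n, (j : ℚ) ^ m ∈ padicIntegralRat p :=
    sum_mem fun j _ => pow_mem (natCast_mem _ j) _
  set T := ∑ j ∈ Icc 1 n, (j : ℚ) ^ m
  set B := bernoulli (m + 1)
  have hp0 : (p : ℚ) ≠ 0 := by
    have : p ≠ 0 := by omega
    exact_mod_cast this
  have hmp : (m : ℚ) = p - 4 := by rw [hm]; push_cast; ring
  rw [show p - 1 = m + 3 by omega] at h2pow
  push_cast at h1 h2 h2pow
  have key : (2 ^ (m + 1) - 1) * (B + p * r) = -2 ^ m * (p - 3) * T + p * (2 ^ (m + 1) * a - b) := by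
    apply mul_left_cancel₀ hp0
    rw [hmp] at h1 h2
    linear_combination 2 ^ (m + 1) * h1 - h2
  have hw : (2 * e * (B + p * r) - 6 * r + T + e * (p - 3) * T - 8 * (2 ^ (m + 1) * a - b)) *
      ((3 : ℕ) : ℚ)⁻¹ ∈ padicIntegralRat p := by
    have hp : (p : ℚ) ∈ padicIntegralRat p := natCast_mem _ p
    have h2 : (2 : ℚ) ∈ padicIntegralRat p := natCast_mem _ 2
    have h6 : (6 : ℚ) ∈ padicIntegralRat p := natCast_mem _ 6
    have h8 : (8 : ℚ) ∈ padicIntegralRat p := natCast_mem _ 8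
    have h3' : (3 : ℚ) ∈ padicIntegralRat p := natCast_mem _ 3
    refine mul_mem (sub_mem (add_mem (add_mem (sub_mem ?_ (mul_mem h6 hr)) hT) ?_) ?_) h3
    · exact mul_mem (mul_mem h2 he) (add_mem hB (mul_mem hp hr))
    · exact mul_mem (mul_mem he (sub_mem hp h3')) hT
    · exact mul_mem h8 (sub_mem (mul_mem (pow_mem h2 _) ha) hb)
  refine ⟨_, hw, ?_⟩
  push_cast
  linear_combination (2 * (B + p * r) + (p - 3) * T) / 3 * h2pow - 8 / 3 * key

end

theorem sum_inv_sq_half_congr (p : ℕ) (hp : p.Prime) (hp5 : 5 ≤ p) :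
    padicNorm p
        ((∑ j ∈ Icc 1 ((p - 1) / 2), 1 / (j : ℚ) ^ 2) - (7 / 3) * p * bernoulli (p - 3)) ≤
      (p : ℚ) ^ (-(2 : ℤ)) := by
  have : Fact p.Prime := ⟨hp⟩
  obtain ⟨n, hpn⟩ := hp.odd_of_ne_two (by omega)
  obtain ⟨a, ha, h1⟩ := exists_sum_inv_sq_half_eq hp5 hpn
  obtain ⟨b, hb, h2⟩ := exists_sum_pow_half_eq hp5 hpn
  have hT : ∃ c ∈ padicIntegralRat p, ∑ j ∈ Icc 1 n, ((j : ℚ) ^ 3)⁻¹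
      = ∑ j ∈ Icc 1 n, (j : ℚ) ^ (p - 4) + p * c := by
    have h : ∀ j ∈ Icc 1 n, ∃ c ∈ padicIntegralRat p,
        ((j : ℚ) ^ 3)⁻¹ = (j : ℚ) ^ (p - 4) + p * c := by
      intro j hj
      rw [mem_Icc] at hj
      obtain ⟨e, he, hpow⟩ :=
        padicIntegralRat.exists_pow_card_sub_one_eq (p := p) (k := j) (by omega) (by omega)
      have hj0 : (j : ℚ) ≠ 0 := by
        have : j ≠ 0 := by omega
        exact_mod_cast this
      refine ⟨-((j : ℚ)⁻¹ ^ 3 * e), neg_mem (mul_mem (pow_mem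
        (padicIntegralRat.inv_natCast_mem (by omega) (by omega)) _) he), ?_⟩
      rw [show p - 1 = p - 4 + 3 by omega, pow_add] at hpow
      field_simp
      linear_combination -hpow
    choose! c hcA hc using h
    refine ⟨∑ j ∈ Icc 1 n, c j, sum_mem hcA, ?_⟩
    rw [mul_sum, ← sum_add_distrib]
    exact sum_congr rfl hc
  obtain ⟨c, hc, h3⟩ := hT
  have h2inv := padicIntegralRat.inv_natCast_mem (p := p) (k := 2) (by omega) (by omega)
  have h3inv := padicIntegralRat.inv_natCast_mem (p := p) (k := 3) (by omega) (by omega)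
  have hmem : a - 7 * (((2 : ℕ) : ℚ)⁻¹ * ((3 : ℕ) : ℚ)⁻¹) * (b + c) ∈ padicIntegralRat p :=
    sub_mem ha (mul_mem (mul_mem (natCast_mem _ 7) (mul_mem h2inv h3inv)) (add_mem hb hc))
  convert padicIntegralRat.padicNorm_pow_mul_le hmem 2 using 2
  swap
  · norm_num
  rw [show (p - 1) / 2 = n by omega]
  simp only [one_div]
  push_cast
  linear_combination h1 - (7 / 6) * p * (h3 + h2)
end

section
/- For any prime $p \ge 5$, $\sum_{j=1}^{(p-1)/2} \frac{1}{j^3} \equiv -2 B_{p-3} \pmod{p}$ (as a congruence of rational numbers, i.e. the $p$-adic valuation of the difference is at least $1$). -/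
open Finset

/-- Natural numbers strictly between `0` and `p` have `p`-integral inverses. -/
theorem natCast_inv_mem_padicInt_subring {p : ℕ} [Fact p.Prime] {m : ℕ} (hm : 0 < m)
    (hmp : m < p) : (m : ℚ_[p])⁻¹ ∈ PadicInt.subring p := by
  have h : ‖(m : ℚ_[p])‖ = 1 :=
    Padic.norm_natCast_eq_one_iff.2 (Nat.coprime_of_lt_prime hm.ne' hmp Fact.out)
  simp [PadicInt.mem_subring_iff, h]

theorem exists_padicInt_coe_eq {p : ℕ} [Fact p.Prime] {x : ℚ_[p]}
    (hx : x ∈ PadicInt.subring p) : ∃ r : ℤ_[p], (r : ℚ_[p]) = x :=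
  ⟨⟨x, hx⟩, rfl⟩

/-- The positive-convention Bernoulli numbers of index `i < p - 1` are `p`-integral. -/
theorem bernoulli'_mem_padicInt_subring {p : ℕ} [Fact p.Prime] (i : ℕ) (hi : i + 1 < p) :
    ((bernoulli' i : ℚ) : ℚ_[p]) ∈ PadicInt.subring p := by
  induction i using Nat.strong_induction_on with
  | _ i ih =>
    rw [bernoulli'_def]
    push_cast
    refine sub_mem (one_mem _) (sum_mem fun k hk => ?_)
    have hk := mem_range.1 hk
    have h := natCast_inv_mem_padicInt_subring (p := p) (m := i - k + 1) (by omega) (by omega)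
    rw [Nat.cast_add, Nat.cast_sub hk.le, Nat.cast_one] at h
    rw [div_eq_mul_inv]
    exact mul_mem (mul_mem (natCast_mem _ _) h) (ih k hk (by omega))

/-- The Bernoulli numbers `B i` with `i < p - 1` are `p`-integral. -/
theorem bernoulli_mem_padicInt_subring {p : ℕ} [Fact p.Prime] (i : ℕ) (hi : i + 1 < p) :
    ((bernoulli i : ℚ) : ℚ_[p]) ∈ PadicInt.subring p := by
  rw [bernoulli]
  push_cast
  exact mul_mem (pow_mem (neg_mem (one_mem _)) _) (bernoulli'_mem_padicInt_subring i hi)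

/-- The sum of the `n`-th powers of the residues modulo `p` is `p * B n` modulo `p ^ 2`. -/
theorem sq_dvd_sum_range_pow_sub {p : ℕ} [Fact p.Prime] {n : ℕ} (hn : n + 1 < p) {b : ℤ_[p]}
    (hb : (b : ℚ_[p]) = (bernoulli n : ℚ)) :
    (p : ℤ_[p]) ^ 2 ∣ (∑ k ∈ range p, (k : ℤ_[p]) ^ n) - p * b := by
  have hmem : ∑ i ∈ range n, ((bernoulli i : ℚ) : ℚ_[p]) * ((n + 1).choose i : ℚ_[p]) *
      (p : ℚ_[p]) ^ (n - 1 - i) * ((n + 1 : ℕ) : ℚ_[p])⁻¹ ∈ PadicInt.subring p := by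
    refine sum_mem fun i hi => ?_
    have hi := mem_range.1 hi
    exact mul_mem (mul_mem (mul_mem (bernoulli_mem_padicInt_subring i (by omega))
      (natCast_mem _ _)) (pow_mem (natCast_mem _ _) _))
      (natCast_inv_mem_padicInt_subring (by omega) hn)
  obtain ⟨r, hr⟩ := exists_padicInt_coe_eq hmem
  refine ⟨r, ?_⟩
  have hn0 : (n + 1 : ℚ_[p]) ≠ 0 := by exact_mod_cast n.succ_ne_zero
  have hF := congrArg (Rat.cast : ℚ → ℚ_[p]) (sum_range_pow p n)
  rw [sum_range_succ] at hF
  push_cast at hF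
  refine PadicInt.ext ?_
  simp only [PadicInt.coe_sub, PadicInt.coe_sum, PadicInt.coe_mul, PadicInt.coe_pow,
    PadicInt.coe_natCast]
  rw [hF, hb, hr, mul_sum]
  have hlead : ((bernoulli n : ℚ) : ℚ_[p]) * ((n + 1).choose n) * p ^ (n + 1 - n) / (n + 1) =
      p * (bernoulli n : ℚ) := by
    rw [Nat.choose_succ_self_right, Nat.add_sub_cancel_left, pow_one]
    push_cast
    field_simp
  push_cast
  rw [hlead, add_sub_cancel_right]
  refine sum_congr rfl fun i hi => ?_
  have hi := mem_range.1 hi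
  rw [show n + 1 - i = 2 + (n - 1 - i) by omega, pow_add]
  ring

theorem sum_range_two_mul_add_one_eq_halves (h : ℕ) (f : ℤ → ℤ) (hf : f 0 = 0) :
    ∑ k ∈ range (2 * h + 1), f k =
      ∑ j ∈ range h, (f (j + 1) + f ((2 * h + 1 : ℕ) - (j + 1))) := by
  rw [sum_range_succ', two_mul, sum_range_add, sum_add_distrib,
    ← sum_range_reflect (fun j : ℕ => f ((h + h + 1 : ℕ) - ((j : ℤ) + 1)))]
  simp only [Nat.cast_zero, hf, add_zero]
  congr 1
  refine sum_congr rfl fun j hj => ?_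
  have hj := mem_range.1 hj
  congr 1
  omega

theorem sum_range_two_mul_add_one_eq_parity (h : ℕ) (f : ℤ → ℤ) (hf : f 0 = 0) :
    ∑ k ∈ range (2 * h + 1), f k =
      ∑ j ∈ range h, (f (2 * (j + 1)) + f ((2 * h + 1 : ℕ) - 2 * (j + 1))) := by
  have key : ∀ m : ℕ, ∑ k ∈ range (2 * m + 1), f k =
      ∑ j ∈ range m, f (2 * (j + 1)) + ∑ j ∈ range m, f (2 * j + 1) := by
    intro m
    induction m with
    | zero => simp [hf]
    | succ m ih =>
      rw [show 2 * (m + 1) + 1 = 2 * m + 1 + 1 + 1 by ring, sum_range_succ, sum_range_succ, ih,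
        sum_range_succ, sum_range_succ]
      push_cast
      ring_nf
  rw [key, sum_add_distrib, ← sum_range_reflect (fun j : ℕ => f (2 * (j : ℤ) + 1))]
  congr 1
  refine sum_congr rfl fun j hj => ?_
  have hj := mem_range.1 hj
  congr 1
  omega

theorem sq_dvd_sub_pow_sub (q x : ℤ) {n : ℕ} (hn : Even n) :
    q ^ 2 ∣ (q - x) ^ n - (x ^ n - n * q * x ^ (n - 1)) := by
  obtain ⟨k, hk⟩ := Polynomial.powAddExpansion x (-q) n
  refine ⟨k, ?_⟩
  rw [← hn.neg_pow (q - x), neg_sub, sub_eq_add_neg x q, hk]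
  ring

/-- Comparing the two ways of pairing `x` with `q - x` modulo `q ^ 2`, for odd `q = 2 * h + 1`. -/
theorem sq_dvd_two_pow_sub_one_mul_sum_range_pow (h : ℕ) {n : ℕ} (hn : Even n) (hn0 : n ≠ 0) :
    ((2 * h + 1 : ℕ) : ℤ) ^ 2 ∣ (2 ^ n - 1) * ∑ k ∈ range (2 * h + 1), (k : ℤ) ^ n +
      n * (2 * h + 1 : ℕ) * 2 ^ (n - 1) * ∑ j ∈ range h, ((j : ℤ) + 1) ^ (n - 1) := by
  have hA := sum_range_two_mul_add_one_eq_halves h (· ^ n) (zero_pow hn0)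
  have hB := sum_range_two_mul_add_one_eq_parity h (· ^ n) (zero_pow hn0)
  set q : ℤ := ((2 * h + 1 : ℕ) : ℤ)
  have key : (2 ^ n - 1) * ∑ k ∈ range (2 * h + 1), (k : ℤ) ^ n +
      n * q * 2 ^ (n - 1) * ∑ j ∈ range h, ((j : ℤ) + 1) ^ (n - 1) =
      ∑ j ∈ range h, (2 ^ n * ((q - (j + 1)) ^ n -
        (((j : ℤ) + 1) ^ n - n * q * ((j : ℤ) + 1) ^ (n - 1))) -
        ((q - 2 * (j + 1)) ^ n -
        ((2 * ((j : ℤ) + 1)) ^ n - n * q * (2 * ((j : ℤ) + 1)) ^ (n - 1)))) := by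
    rw [sub_one_mul]
    nth_rewrite 1 [hA]
    rw [hB, mul_sum, mul_sum, ← sum_sub_distrib, ← sum_add_distrib]
    refine sum_congr rfl fun j _ => ?_
    obtain ⟨m, rfl⟩ := Nat.exists_eq_succ_of_ne_zero hn0
    simp only [Nat.succ_eq_add_one, Nat.add_sub_cancel, mul_pow]
    ring
  rw [key]
  exact dvd_sum fun j _ => dvd_sub (dvd_mul_of_dvd_right (sq_dvd_sub_pow_sub _ _ hn) _)
    (sq_dvd_sub_pow_sub _ _ hn)

theorem prime_dvd_natCast_pow_sub_one {p : ℕ} [Fact p.Prime] {m : ℕ} (hm : 0 < m)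
    (hmp : m < p) : (p : ℤ_[p]) ∣ (m : ℤ_[p]) ^ (p - 1) - 1 := by
  have h : (p : ℤ) ∣ (m : ℤ) ^ (p - 1) - 1 :=
    (Int.ModEq.pow_card_sub_one_eq_one Fact.out (Nat.isCoprime_iff_coprime.2
      (Nat.coprime_of_lt_prime hm.ne' hmp Fact.out).symm)).symm.dvd
  simpa using map_dvd (Int.castRingHom ℤ_[p]) h

/-- The half power sum of exponent `p - 4`, modulo `p`. -/
theorem prime_dvd_sum_pow_add_two_mul_bernoulli {p : ℕ} [Fact p.Prime] {h : ℕ}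
    (hp : p = 2 * h + 1) (hp5 : 5 ≤ p) {b : ℤ_[p]}
    (hb : (b : ℚ_[p]) = (bernoulli (p - 3) : ℚ)) :
    (p : ℤ_[p]) ∣ ∑ j ∈ range h, ((j : ℤ_[p]) + 1) ^ (p - 4) + 2 * b := by
  have hprime : Prime (p : ℤ_[p]) := PadicInt.prime_p
  have h1 := map_dvd (Int.castRingHom ℤ_[p]) (sq_dvd_two_pow_sub_one_mul_sum_range_pow h
    (n := p - 3) ⟨h - 1, by omega⟩ (by omega))
  rw [← hp] at h1
  have h2 := sq_dvd_sum_range_pow_sub (n := p - 3) (by omega) hb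
  rw [show p - 3 - 1 = p - 4 by omega] at h1
  simp only [eq_intCast] at h1
  push_cast at h1
  set S := ∑ k ∈ range p, (k : ℤ_[p]) ^ (p - 3)
  set U := ∑ j ∈ range h, ((j : ℤ_[p]) + 1) ^ (p - 4)
  have h3 : (p : ℤ_[p]) ∣ (2 ^ (p - 3) - 1) * b + (p - 3 : ℕ) * 2 ^ (p - 4) * U := by
    have h4 := dvd_sub h1 (dvd_mul_of_dvd_right h2 (2 ^ (p - 3) - 1))
    rw [sq] at h4
    refine (mul_dvd_mul_iff_left hprime.ne_zero).1 (h4.trans (dvd_of_eq ?_))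
    ring
  obtain ⟨c, hc⟩ := h3
  obtain ⟨d, hd⟩ := prime_dvd_natCast_pow_sub_one (p := p) two_pos (by omega)
  have h3U : (p : ℤ_[p]) ∣ (3 : ℕ) * (U + 2 * b) := by
    rw [show p - 3 = p - 4 + 1 by omega, show (((p - 4 + 1 : ℕ)) : ℤ_[p]) = p - 3 by
      rw [show p - 4 + 1 = p - 3 by omega, Nat.cast_sub (by omega)]; norm_num] at hc
    rw [show p - 1 = p - 4 + 3 by omega] at hd
    push_cast at hd
    refine ⟨U - 8 * c + 2 * d * b + (p - 3) * d * U, ?_⟩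
    push_cast
    linear_combination (-8) * hc + (2 * b + (p - 3) * U) * hd
  refine (hprime.dvd_or_dvd h3U).resolve_left fun h3 => ?_
  obtain ⟨e, he⟩ := h3
  have hm := (PadicInt.norm_lt_one_iff_dvd ((3 : ℕ) : ℤ_[p])).2 ⟨e, he⟩
  rw [PadicInt.norm_natCast_eq_one_iff.2
    (Nat.coprime_of_lt_prime (by norm_num) (by omega) Fact.out)] at hm
  exact lt_irrefl _ hm

theorem sum_inv_cube_half_congr (p : ℕ) (hp : p.Prime) (hp5 : 5 ≤ p) :
    padicNorm p ((∑ j ∈ Icc 1 ((p - 1) / 2), 1 / (j : ℚ) ^ 3) - (-2 * bernoulli (p - 3))) ≤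
      (p : ℚ) ^ (-(1 : ℤ)) := by
  have := Fact.mk hp
  obtain ⟨h, hh⟩ := hp.odd_of_ne_two (by omega)
  rw [show (p - 1) / 2 = h by omega]
  obtain ⟨b, hb⟩ :=
    exists_padicInt_coe_eq (bernoulli_mem_padicInt_subring (p := p) (p - 3) (by omega))
  have hU := prime_dvd_sum_pow_add_two_mul_bernoulli hh hp5 hb
  have hex : ∀ j ∈ range h, ∃ v : ℤ_[p], (v : ℚ_[p]) = ((j + 1 : ℕ) : ℚ_[p])⁻¹ := fun j hj =>
    exists_padicInt_coe_eq
      (natCast_inv_mem_padicInt_subring j.succ_pos (by have := mem_range.1 hj; omega))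
  choose! v hv using hex
  have hmul : ∀ j ∈ range h, ((j : ℤ_[p]) + 1) * v j = 1 := fun j hj => by
    have hj0 : (j + 1 : ℚ_[p]) ≠ 0 := by exact_mod_cast j.succ_ne_zero
    refine PadicInt.ext ?_
    push_cast
    rw [hv j hj]
    push_cast
    exact mul_inv_cancel₀ hj0
  have hV : (p : ℤ_[p]) ∣ ∑ j ∈ range h, v j ^ 3 + 2 * b := by
    have hd : (p : ℤ_[p]) ∣ ∑ j ∈ range h, (((j : ℤ_[p]) + 1) ^ (p - 4) - v j ^ 3) := by
      refine dvd_sum fun j hj => ?_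
      have hF := prime_dvd_natCast_pow_sub_one (p := p) j.succ_pos
        (by have := mem_range.1 hj; omega)
      refine (dvd_mul_of_dvd_right hF (v j ^ 3)).trans (dvd_of_eq ?_)
      have h3 : ((j : ℤ_[p]) + 1) ^ 3 * v j ^ 3 = 1 := by rw [← mul_pow, hmul j hj, one_pow]
      rw [show p - 1 = p - 4 + 3 by omega]
      push_cast
      linear_combination ((j : ℤ_[p]) + 1) ^ (p - 4) * h3
    rw [sum_sub_distrib] at hd
    refine (dvd_sub hU hd).trans (dvd_of_eq ?_)
    ring
  have hnorm := (PadicInt.norm_le_pow_iff_mem_span_pow _ 1).2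
    (Ideal.mem_span_singleton.2 (by simpa using hV))
  have hcast : ((∑ j ∈ range h, v j ^ 3 + 2 * b : ℤ_[p]) : ℚ_[p]) =
      (((∑ j ∈ Icc 1 h, 1 / (j : ℚ) ^ 3) - (-2 * bernoulli (p - 3)) : ℚ) : ℚ_[p]) := by
    have h2 : ((2 : ℤ_[p]) : ℚ_[p]) = 2 := PadicInt.coe_natCast 2
    rw [← Finset.Ico_add_one_right_eq_Icc, sum_Ico_eq_sum_range, Nat.add_sub_cancel,
      PadicInt.coe_add, PadicInt.coe_sum, PadicInt.coe_mul, h2, hb]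
    push_cast
    rw [neg_mul, sub_neg_eq_add]
    congr 1
    refine sum_congr rfl fun j hj => ?_
    rw [hv j hj]
    push_cast
    rw [inv_pow, one_div, add_comm]
  rw [PadicInt.norm_def, hcast, Padic.eq_padicNorm] at hnorm
  rw [← Rat.cast_le (K := ℝ)]
  simpa using hnorm
end

section
/- Let $p \ge 5$ be a prime and $n, k \in \mathbb{N}$ with $n > k$. Then for every integer $j$ with $1 \le j \le \frac{p-1}{2}$, $\binom{2kp+2j}{kp+j}\binom{2np-2kp-2j}{np-kp-j} \equiv \frac{2p}{j}\binom{2k}{k}\binom{2n-2k-2}{n-k-1}(2k+1-2n) \pmod{p^2}$ (as a congruence of rational numbers, i.e. the $p$-adic valuation of the difference is at least $2$). -/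
theorem Nat.centralBinom_mul_add_modEq {p : ℕ} (hp : p.Prime) (k : ℕ) {j : ℕ} (hj : 2 * j < p) :
    Nat.centralBinom (k * p + j) ≡ Nat.centralBinom j * Nat.centralBinom k [MOD p] := by
  have := Fact.mk hp
  have h := Choose.choose_modEq_choose_mod_mul_choose_div_nat
    (n := 2 * (k * p + j)) (k := k * p + j) (p := p)
  have e : 2 * (k * p + j) = 2 * j + p * (2 * k) := by ring
  have e' : k * p + j = j + p * k := by ring
  have h1 : (2 * (k * p + j)) % p = 2 * j := by
    rw [e, Nat.add_mul_mod_self_left, Nat.mod_eq_of_lt hj]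
  have h2 : (k * p + j) % p = j := by
    rw [e', Nat.add_mul_mod_self_left, Nat.mod_eq_of_lt (by omega)]
  have h3 : (2 * (k * p + j)) / p = 2 * k := by
    rw [e, Nat.add_mul_div_left _ _ hp.pos, Nat.div_eq_of_lt hj, zero_add]
  have h4 : (k * p + j) / p = k := by
    rw [e', Nat.add_mul_div_left _ _ hp.pos, Nat.div_eq_of_lt (by omega), zero_add]
  rw [h1, h2, h3, h4] at h
  exact h

theorem Int.sq_dvd_mul_centralBinom_mul_centralBinom_mul_sub_add {p : ℕ} (hp : p.Prime)
    (hp2 : 2 < p) (r : ℕ) {j : ℕ} (hj : 1 ≤ j) (hjp : 2 * j < p) :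
    (p : ℤ) ∣ Nat.centralBinom ((r + 1) * p - j) ∧
      (p : ℤ) ^ 2 ∣ j * Nat.centralBinom j * Nat.centralBinom ((r + 1) * p - j) +
        2 * p * (2 * r + 1) * Nat.centralBinom r := by
  have hpZ : Prime (p : ℤ) := Nat.prime_iff_prime_int.mp hp
  have h_not_dvd : ∀ i : ℕ, 2 * i + 1 < p → ¬ (p : ℤ) ∣ 2 * (2 * ((r + 1) * p) - (2 * i + 1)) := by
    intro i hi h
    rcases hpZ.dvd_or_dvd h with h | h
    · have := Int.le_of_dvd (by norm_num) h
      omega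
    · have h' : (p : ℤ) ∣ 2 * i + 1 :=
        (dvd_sub_right ((dvd_mul_left (p : ℤ) (r + 1)).mul_left 2)).mp h
      have := Int.le_of_dvd (by positivity) h'
      omega
  have h_rec : ∀ i : ℕ, i < p →
      ((r + 1) * p - i : ℤ) * Nat.centralBinom ((r + 1) * p - i) =
        2 * (2 * ((r + 1) * p) - (2 * i + 1)) *
          Nat.centralBinom ((r + 1) * p - (i + 1)) := by
    intro i hi
    have hle : i + 1 ≤ (r + 1) * p := by nlinarith
    obtain ⟨N, hN⟩ := Nat.exists_eq_add_of_le hle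
    have e1 : (r + 1) * p - i = N + 1 := by omega
    have e2 : (r + 1) * p - (i + 1) = N := by omega
    have hNZ : ((r + 1) * p : ℤ) = i + 1 + N := by exact_mod_cast hN
    have h : ((N + 1 : ℕ) * Nat.centralBinom (N + 1) : ℤ) =
        2 * (2 * N + 1) * Nat.centralBinom N := by
      exact_mod_cast Nat.succ_mul_centralBinom_succ N
    rw [e1, e2, hNZ]
    push_cast at h
    linear_combination h
  induction j, hj using Nat.le_induction with
  | base =>
    have h0 := h_rec 0 hp.pos
    simp only [Nat.sub_zero, zero_add, Nat.cast_zero, sub_zero, mul_zero] at h0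
    have hd : (p : ℤ) ∣ Nat.centralBinom ((r + 1) * p - 1) := by
      refine (hpZ.dvd_or_dvd ?_).resolve_left (by simpa using h_not_dvd 0 (by omega))
      refine ⟨(r + 1) * Nat.centralBinom ((r + 1) * p), ?_⟩
      linear_combination -h0
    refine ⟨hd, ?_⟩
    obtain ⟨b, hb⟩ := hd
    have hl := Nat.centralBinom_mul_add_modEq hp (r + 1) (j := 0) hp.pos
    rw [add_zero, Nat.centralBinom_zero, one_mul] at hl
    obtain ⟨c, hc⟩ := (Nat.modEq_iff_dvd.mp hl)
    have hs : ((r + 1) * Nat.centralBinom (r + 1) : ℤ) =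
        2 * (2 * r + 1) * Nat.centralBinom r := by
      exact_mod_cast Nat.succ_mul_centralBinom_succ r
    rw [show Nat.centralBinom 1 = 2 from rfl]
    rw [hb] at h0 ⊢
    refine ⟨4 * (r + 1) * b + (r + 1) * c, ?_⟩
    push_cast
    linear_combination h0 + (r + 1) * p * hc - p * hs
  | succ i hi ih =>
    obtain ⟨hd, h⟩ := ih (by omega)
    have h0 := h_rec i (by omega)
    have hd' : (p : ℤ) ∣ Nat.centralBinom ((r + 1) * p - (i + 1)) := by
      refine (hpZ.dvd_or_dvd ?_).resolve_left (h_not_dvd i (by omega))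
      rw [← h0]
      exact hd.mul_left _
    refine ⟨hd', ?_⟩
    obtain ⟨b, hb⟩ := hd
    obtain ⟨b', hb'⟩ := hd'
    obtain ⟨c, hc⟩ := h
    have hs : ((i + 1) * Nat.centralBinom (i + 1) : ℤ) =
        2 * (2 * i + 1) * Nat.centralBinom i := by
      exact_mod_cast Nat.succ_mul_centralBinom_succ i
    rw [hb] at h0 hc
    rw [hb'] at h0 ⊢
    refine ⟨c + Nat.centralBinom i * (4 * (r + 1) * b' - (r + 1) * b), ?_⟩
    push_cast
    linear_combination p * b' * hs + hc + Nat.centralBinom i * h0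

theorem central_binom_prod_congr_first_half (p : ℕ) (hp : p.Prime) (hp5 : 5 ≤ p)
    (n k : ℕ) (hkn : k < n) (j : ℕ) (hj1 : 1 ≤ j) (hj2 : j ≤ (p - 1) / 2) :
    padicNorm p
        (((2 * k * p + 2 * j).choose (k * p + j) : ℚ) *
            ((2 * n * p - 2 * k * p - 2 * j).choose (n * p - k * p - j)) -
          (2 * p / (j : ℚ)) * ((2 * k).choose k) * ((2 * n - 2 * k - 2).choose (n - k - 1)) *
            (2 * (k : ℚ) + 1 - 2 * n)) ≤
      (p : ℚ) ^ (-(2 : ℤ)) := by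
  have := Fact.mk hp
  have hjp : 2 * j < p := by omega
  obtain ⟨r, rfl⟩ := Nat.exists_eq_add_of_lt hkn
  have e1 : 2 * k * p + 2 * j = 2 * (k * p + j) := by ring
  have e2 : (k + r + 1) * p - k * p - j = (r + 1) * p - j := by
    rw [← Nat.sub_mul]
    congr 2
    omega
  have e3 : 2 * (k + r + 1) * p - 2 * k * p - 2 * j = 2 * ((r + 1) * p - j) := by
    rw [← e2, Nat.mul_sub, Nat.mul_sub, mul_assoc, mul_assoc]
  have e4 : 2 * (k + r + 1) - 2 * k - 2 = 2 * r := by omega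
  have e5 : k + r + 1 - k - 1 = r := by omega
  rw [e1, e2, e3, e4, e5]
  simp only [← Nat.centralBinom_eq_two_mul_choose]
  obtain ⟨⟨b, hb⟩, c, hc⟩ :=
    Int.sq_dvd_mul_centralBinom_mul_centralBinom_mul_sub_add hp (by omega) r hj1 hjp
  obtain ⟨d, hd⟩ := Nat.modEq_iff_dvd.mp (Nat.centralBinom_mul_add_modEq hp k hjp)
  push_cast at hd
  have hjQ : (j : ℚ) ≠ 0 := by positivity
  have key : ((p ^ 2 : ℕ) : ℤ) ∣ j * (Nat.centralBinom (k * p + j) *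
      Nat.centralBinom ((r + 1) * p - j)) +
        2 * p * Nat.centralBinom k * Nat.centralBinom r * (2 * r + 1) := by
    refine ⟨Nat.centralBinom k * c - j * b * d, ?_⟩
    rw [hb] at hc ⊢
    push_cast
    linear_combination Nat.centralBinom k * hc - j * p * b * hd
  have hnorm : padicNorm p (j : ℚ) = 1 := by
    rw [padicNorm.nat_eq_one_iff]
    exact fun h => absurd (Nat.le_of_dvd (by omega) h) (by omega)
  have key' := (padicNorm.dvd_iff_norm_le (p := p) (n := 2)).mp key
  have h_mul : ∀ x : ℚ, padicNorm p x = padicNorm p (j * x) := fun x => by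
    rw [padicNorm.mul, hnorm, one_mul]
  rw [h_mul]
  refine le_of_eq_of_le (congrArg _ ?_) key'
  push_cast
  field_simp
  ring
end

section
/- Let $p \ge 5$ be a prime and $n, k \in \mathbb{N}$ with $n > k$. Then for every integer $j$ with $\frac{p+1}{2} \le j \le p-1$, $\binom{2kp+2j}{kp+j}\binom{2np-2kp-2j}{np-kp-j} \equiv \frac{2p}{j}\binom{2k}{k}\binom{2n-2k-2}{n-k-1}(2k+1) \pmod{p^2}$ (as a congruence of rational numbers, i.e. the $p$-adic valuation of the difference is at least $2$). -/
namespace Nat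

theorem cast_choose_mul_add_zmod {p : ℕ} [Fact p.Prime] (a c : ℕ) {b d : ℕ}
    (hb : b < p) (hd : d < p) :
    (((a * p + b).choose (c * p + d) : ℕ) : ZMod p) = a.choose c * b.choose d := by
  have hp : 0 < p := by omega
  have h := Choose.choose_modEq_choose_mod_mul_choose_div_nat
    (n := a * p + b) (k := c * p + d) (p := p)
  rw [mul_comm a, mul_comm c, mul_add_mod, mul_add_mod, mod_eq_of_lt hb, mod_eq_of_lt hd,
    mul_add_div hp, mul_add_div hp, div_eq_of_lt hb, div_eq_of_lt hd,
    ← ZMod.natCast_eq_natCast_iff] at h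
  rw [mul_comm a, mul_comm c, h]
  push_cast
  simp only [add_zero]
  ring

theorem cast_choose_pred_prime_zmod {p : ℕ} [Fact p.Prime] {k : ℕ} (hk : k < p) :
    (((p - 1).choose k : ℕ) : ZMod p) = (-1) ^ k := by
  have hp : p.Prime := Fact.out
  induction k with
  | zero => simp
  | succ k ih =>
    have hsum : p.choose (k + 1) = (p - 1).choose k + (p - 1).choose (k + 1) := by
      obtain ⟨q, rfl⟩ : ∃ q, p = q + 1 := ⟨p - 1, by omega⟩
      exact choose_succ_succ' _ _
    have hdvd : ((p.choose (k + 1) : ℕ) : ZMod p) = 0 :=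
      (ZMod.natCast_eq_zero_iff _ _).2 (hp.dvd_choose_self (succ_ne_zero k) hk)
    rw [hsum, cast_add, ih (by omega)] at hdvd
    rw [pow_succ]
    linear_combination hdvd

theorem exists_choose_two_mul_eq_prime_mul {p : ℕ} [Fact p.Prime] {s t : ℕ}
    (hp : p = 2 * t + 3 + s) (k : ℕ) :
    ∃ x : ℕ, (2 * (k * p + (t + s + 2))).choose (k * p + (t + s + 2)) = p * x ∧
      (x : ZMod p) * ((t + s + 2).choose t * (s + 2)) =
        (2 * k + 1) * (2 * k).choose k * (-1) ^ t := by
  have hprime : p.Prime := Fact.out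
  set B := k * p + (t + s + 2) with hB
  have hBB : 2 * B = (2 * k + 1) * p + (s + 1) := by rw [hB, hp]; ring
  have hmul := choose_mul (n := 2 * B) (k := B) (s := s + 2) (by omega)
  have hpred : 2 * B - (s + 2) = 2 * k * p + (p - 1) := by
    rw [hBB, add_mul]; omega
  have hsymm : (2 * B - (s + 2)).choose (B - (s + 2)) = (2 * k * p + (p - 1)).choose B := by
    rw [← choose_symm (by omega), hpred]; congr 1; omega
  have hsucc := choose_succ_right_eq (2 * B) (s + 1)
  rw [show 2 * B - (s + 1) = (2 * k + 1) * p by omega] at hsucc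
  have hkey : (2 * B).choose B * (B.choose (s + 2) * (s + 2)) =
      p * ((2 * k + 1) * (2 * B).choose (s + 1) * (2 * k * p + (p - 1)).choose B) := by
    rw [hsymm] at hmul
    linear_combination (s + 2) * hmul + (2 * k * p + (p - 1)).choose B * hsucc
  have hjt : (t + s + 2).choose (s + 2) = (t + s + 2).choose t := by
    rw [show t + s + 2 = t + (s + 2) by ring, choose_symm_add]
  have hBchoose : ((B.choose (s + 2) : ℕ) : ZMod p) = (t + s + 2).choose t := by
    have := cast_choose_mul_add_zmod (p := p) k 0 (b := t + s + 2) (d := s + 2)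
      (by omega) (by omega)
    simpa [hjt] using this
  have htop : (((2 * B).choose (s + 1) : ℕ) : ZMod p) = 1 := by
    have := cast_choose_mul_add_zmod (p := p) (2 * k + 1) 0 (b := s + 1) (d := s + 1)
      (by omega) (by omega)
    rw [hBB]
    simpa using this
  have hlast : (((2 * k * p + (p - 1)).choose B : ℕ) : ZMod p) =
      (2 * k).choose k * (-1) ^ t := by
    rw [hB, cast_choose_mul_add_zmod _ _ (by omega) (by omega),
      ← cast_choose_pred_prime_zmod (p := p) (k := t) (by omega),
      choose_symm_of_eq_add (show p - 1 = (t + s + 2) + t by omega)]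
  have hndvd : ¬ p ∣ B.choose (s + 2) * (s + 2) := by
    rw [hprime.dvd_mul, not_or]
    refine ⟨?_, fun h => absurd (le_of_dvd (by omega) h) (by omega)⟩
    rw [← ZMod.natCast_eq_zero_iff, hBchoose, ZMod.natCast_eq_zero_iff]
    intro h
    exact absurd ((hprime.dvd_factorial).1
      (h.trans (Dvd.intro _ ((mul_assoc _ _ _).symm.trans
        (choose_mul_factorial_mul_factorial (show t ≤ t + s + 2 by omega)))))) (by omega)
  obtain ⟨x, hx⟩ : p ∣ (2 * B).choose B :=
    (hprime.dvd_mul.1 (Dvd.intro _ hkey.symm)).resolve_right hndvd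
  refine ⟨x, hx, ?_⟩
  rw [hx, mul_assoc] at hkey
  have hcast := congrArg (Nat.cast : ℕ → ZMod p) (mul_left_cancel₀ hprime.ne_zero hkey)
  push_cast [hBchoose, htop, hlast] at hcast
  linear_combination hcast

theorem sq_dvd_central_choose_mul_sub {p : ℕ} [Fact p.Prime] {s t : ℕ}
    (hp : p = 2 * t + 3 + s) (k m : ℕ) :
    ((p ^ 2 : ℕ) : ℤ) ∣ (2 * (k * p + (t + s + 2))).choose (k * p + (t + s + 2)) *
        (2 * (m * p + (t + 1))).choose (m * p + (t + 1)) * (t + s + 2 : ℕ) -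
      2 * p * (2 * k).choose k * (2 * m).choose m * (2 * k + 1) := by
  obtain ⟨x, hx, hxmod⟩ := exists_choose_two_mul_eq_prime_mul hp k
  have hy : (((2 * (m * p + (t + 1))).choose (m * p + (t + 1)) : ℕ) : ZMod p) =
      (2 * m).choose m * (2 * (t + 1)).choose (t + 1) := by
    rw [mul_add, ← mul_assoc, cast_choose_mul_add_zmod _ _ (by omega) (by omega)]
  have hrefl : ((2 * t).choose t : ZMod p) = (-1) ^ t * (t + s + 2).choose t := by
    have h := choose_mul (n := p - 1) (k := 2 * t) (s := t) (by omega)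
    rw [show p - 1 - t = t + s + 2 by omega, show 2 * t - t = t by omega] at h
    have h := congrArg (Nat.cast : ℕ → ZMod p) h
    push_cast [cast_choose_pred_prime_zmod (show 2 * t < p by omega),
      cast_choose_pred_prime_zmod (show t < p by omega)] at h
    simpa using h
  have hstep := congrArg (Nat.cast : ℕ → ZMod p) (succ_mul_centralBinom_succ t)
  simp only [centralBinom_eq_two_mul_choose] at hstep
  push_cast at hstep
  have hp0 : (2 * t + 3 + s : ZMod p) = 0 := by
    exact_mod_cast (ZMod.natCast_eq_zero_iff (2 * t + 3 + s) p).2 hp.dvd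
  have hsq : ((-1 : ZMod p) ^ t) ^ 2 = 1 := by rw [← pow_mul, mul_comm, pow_mul]; simp
  have hdvd : (p : ℤ) ∣ x * (2 * (m * p + (t + 1))).choose (m * p + (t + 1)) *
      (t + s + 2 : ℕ) - 2 * (2 * k).choose k * (2 * m).choose m * (2 * k + 1) := by
    rw [← ZMod.intCast_zmod_eq_zero_iff_dvd]
    push_cast [hy]
    have hj : (t + s + 2 : ZMod p) = -(t + 1) := by linear_combination hp0
    have hs : (2 * t + 1 : ZMod p) = -(s + 2) := by linear_combination hp0
    rw [hrefl, hs] at hstep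
    rw [hj]
    linear_combination (-x * (2 * m).choose m : ZMod p) * hstep +
      2 * (2 * m).choose m * (-1) ^ t * hxmod +
      2 * (2 * m).choose m * (2 * k + 1) * (2 * k).choose k * hsq
  obtain ⟨c, hc⟩ := hdvd
  refine ⟨c, ?_⟩
  rw [hx]
  push_cast at hc ⊢
  linear_combination (p : ℤ) * hc

end Nat

theorem central_binom_prod_congr_second_half (p : ℕ) (hp : p.Prime) (hp5 : 5 ≤ p)
    (n k : ℕ) (hkn : k < n) (j : ℕ) (hj1 : (p + 1) / 2 ≤ j) (hj2 : j ≤ p - 1) :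
    padicNorm p
        (((2 * k * p + 2 * j).choose (k * p + j) : ℚ) *
            ((2 * n * p - 2 * k * p - 2 * j).choose (n * p - k * p - j)) -
          (2 * p / (j : ℚ)) * ((2 * k).choose k) * ((2 * n - 2 * k - 2).choose (n - k - 1)) *
            (2 * (k : ℚ) + 1)) ≤
      (p : ℚ) ^ (-(2 : ℤ)) := by
  have : Fact p.Prime := ⟨hp⟩
  have hodd : p % 2 = 1 := hp.eq_two_or_odd.resolve_left (by omega)
  obtain ⟨m, rfl⟩ : ∃ m, n = k + 1 + m := ⟨n - (k + 1), by omega⟩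
  obtain ⟨t, ht⟩ : ∃ t, p = j + t + 1 := ⟨p - 1 - j, by omega⟩
  obtain ⟨s, rfl⟩ : ∃ s, j = t + s + 2 := ⟨j - t - 2, by omega⟩
  have hdvd := Nat.sq_dvd_central_choose_mul_sub (show p = 2 * t + 3 + s by omega) k m
  rw [padicNorm.dvd_iff_norm_le] at hdvd
  have hnorm : padicNorm p ((t + s + 2 : ℕ) : ℚ) = 1 :=
    padicNorm.nat_eq_one_iff _ |>.2 fun h => absurd (Nat.le_of_dvd (by omega) h) (by omega)
  have hj0 : ((t + s + 2 : ℕ) : ℚ) ≠ 0 := by positivity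
  have hN : 2 * k * p + 2 * (t + s + 2) = 2 * (k * p + (t + s + 2)) := by ring
  have hM : (k + 1 + m) * p - k * p - (t + s + 2) = m * p + (t + 1) := by
    rw [add_mul, add_mul]; omega
  have hMM : 2 * (k + 1 + m) * p - 2 * k * p - 2 * (t + s + 2) = 2 * (m * p + (t + 1)) := by
    rw [← hM, Nat.mul_sub, Nat.mul_sub, mul_assoc, mul_assoc]
  rw [hN, hM, hMM, show 2 * (k + 1 + m) - 2 * k - 2 = 2 * m by omega,
    show k + 1 + m - k - 1 = m by omega]
  refine le_of_eq_of_le ?_ hdvd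
  refine (mul_one _).symm.trans ?_
  rw [← hnorm, ← padicNorm.mul]
  congr 1
  rw [hnorm]
  push_cast at hj0 ⊢
  field_simp
end

section
/- Let $p \ge 5$ be a prime, $k \in \mathbb{N}$, and $j$ an integer with $1 \le j \le p-1$. Then $\binom{2kp+2j}{kp+j} \equiv \binom{2k}{k}\binom{2j}{j}\bigl(1 + 2kp(H_{2j} - H_j)\bigr) \pmod{p^2}$ (as a congruence of rational numbers, i.e. the $p$-adic valuation of the difference is at least $2$), where $H_n = \sum_{i=1}^{n} \frac{1}{i}$ denotes the $n$th harmonic number. -/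
/-- The rational number `x` is divisible by `p ^ m` in the ring of `p`-integral rationals. -/
def PadicDvd (p m : ℕ) (x : ℚ) : Prop := padicNorm p x ≤ (p : ℚ) ^ (-(m : ℤ))

namespace PadicDvd

variable {p m n : ℕ} {x y u : ℚ}

lemma neg (hx : PadicDvd p m x) : PadicDvd p m (-x) := by
  rwa [PadicDvd, padicNorm.neg]

lemma zero : PadicDvd p m 0 := by
  rw [PadicDvd, padicNorm.zero]
  positivity

variable [hp : Fact p.Prime]

lemma add (hx : PadicDvd p m x) (hy : PadicDvd p m y) : PadicDvd p m (x + y) :=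
  padicNorm.nonarchimedean.trans (max_le hx hy)

lemma sub (hx : PadicDvd p m x) (hy : PadicDvd p m y) : PadicDvd p m (x - y) := by
  rw [sub_eq_add_neg]
  exact hx.add hy.neg

lemma mul (hx : PadicDvd p m x) (hy : PadicDvd p n y) : PadicDvd p (m + n) (x * y) := by
  have hp0 : (p : ℚ) ≠ 0 := by exact_mod_cast hp.out.ne_zero
  rw [PadicDvd, padicNorm.mul, Nat.cast_add, neg_add, zpow_add₀ hp0]
  exact mul_le_mul hx hy (padicNorm.nonneg _) (by positivity)

lemma mul_left (hx : PadicDvd p 0 x) (hy : PadicDvd p m y) : PadicDvd p m (x * y) := by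
  simpa using hx.mul hy

lemma mul_right (hx : PadicDvd p m x) (hy : PadicDvd p 0 y) : PadicDvd p m (x * y) :=
  hx.mul hy

lemma mono (hx : PadicDvd p m x) (h : n ≤ m) : PadicDvd p n x := by
  refine le_trans hx (zpow_le_zpow_right₀ ?_ (by omega))
  exact_mod_cast hp.out.one_le

lemma natCast (a : ℕ) : PadicDvd p 0 a := by
  simpa [PadicDvd] using padicNorm.of_nat a

lemma one : PadicDvd p 0 1 := by
  simpa using natCast (p := p) 1

lemma two : PadicDvd p 0 2 := by
  simpa using natCast (p := p) 2

lemma self : PadicDvd p 1 p := by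
  simp [PadicDvd, padicNorm.padicNorm_p_of_prime]

lemma natCast_of_dvd {a : ℕ} (h : p ∣ a) : PadicDvd p 1 a := by
  obtain ⟨b, rfl⟩ := h
  rw [Nat.cast_mul]
  exact self.mul_right (natCast b)

lemma inv_natCast {a : ℕ} (h : ¬ p ∣ a) : PadicDvd p 0 ((a : ℚ)⁻¹) := by
  have : padicNorm p ((a : ℚ)⁻¹) = 1 := by
    rw [← one_div, padicNorm.div, padicNorm.one, (padicNorm.nat_eq_one_iff a).2 h, div_one]
  simp [PadicDvd, this]

lemma padicNorm_eq_one (hu : PadicDvd p 1 (u - 1)) : padicNorm p u = 1 := by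
  have h1 : padicNorm p (u - 1) < 1 := by
    refine lt_of_le_of_lt hu ?_
    have : (1 : ℚ) < p := by exact_mod_cast hp.out.one_lt
    simpa using inv_lt_one_of_one_lt₀ this
  have h2 : padicNorm p (u - 1) ≠ padicNorm p 1 := by
    rw [padicNorm.one]
    exact h1.ne
  have := padicNorm.add_eq_max_of_ne h2
  rw [sub_add_cancel, padicNorm.one, max_eq_right h1.le] at this
  exact this

lemma of_mul_right (hu : PadicDvd p 1 (u - 1)) (h : PadicDvd p m (x * u)) : PadicDvd p m x := by
  rwa [PadicDvd, padicNorm.mul, hu.padicNorm_eq_one, mul_one] at h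

lemma ne_zero (hu : PadicDvd p 1 (u - 1)) : u ≠ 0 := by
  rintro rfl
  simpa using hu.padicNorm_eq_one

lemma of_sub_one (hu : PadicDvd p m (u - 1)) : PadicDvd p 0 u := by
  simpa using (hu.mono m.zero_le).add one

lemma mul_sub_one (hx : PadicDvd p m (x - 1)) (hy : PadicDvd p m (y - 1)) :
    PadicDvd p m (x * y - 1) := by
  have := (hx.mul_right hy.of_sub_one).add hy
  rwa [show (x - 1) * y + (y - 1) = x * y - 1 by ring] at this

lemma div_sub_one (hm : 1 ≤ m) (hx : PadicDvd p m (x - 1)) (hy : PadicDvd p m (y - 1)) :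
    PadicDvd p m (x / y - 1) := by
  have hy1 := hy.mono hm
  refine of_mul_right hy1 ?_
  have := hx.sub hy
  rwa [show x - 1 - (y - 1) = (x / y - 1) * y by have := hy1.ne_zero; field_simp; ring] at this

end PadicDvd

/-- The product `∏_{i=1}^{n} (1 + x / i)`. -/
def harmonicProd (x : ℚ) (n : ℕ) : ℚ := ∏ i ∈ Finset.range n, (1 + x * ((i + 1 : ℕ) : ℚ)⁻¹)

lemma harmonicProd_succ (x : ℚ) (n : ℕ) :
    harmonicProd x (n + 1) = harmonicProd x n * (1 + x * ((n + 1 : ℕ) : ℚ)⁻¹) :=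
  Finset.prod_range_succ _ _

lemma factorial_add_eq_harmonicProd (m n : ℕ) :
    ((m + n).factorial : ℚ) = m.factorial * n.factorial * harmonicProd m n := by
  induction n with
  | zero => simp [harmonicProd]
  | succ n ih =>
    rw [← add_assoc, Nat.factorial_succ, Nat.factorial_succ, harmonicProd_succ]
    push_cast
    rw [ih]
    field_simp
    ring

section

variable {p : ℕ} [hp : Fact p.Prime] {x : ℚ}

lemma padicDvd_harmonic {n : ℕ} (hn : n < p) : PadicDvd p 0 (harmonic n) := by
  induction n with
  | zero => simpa using PadicDvd.zero
  | succ n ih =>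
    rw [harmonic_succ]
    exact (ih (by omega)).add
      (PadicDvd.inv_natCast (Nat.not_dvd_of_pos_of_lt (by omega) hn))

lemma padicDvd_harmonicProd_sq (hx : PadicDvd p 1 x) {n : ℕ} (hn : n < p) :
    PadicDvd p 2 (harmonicProd x n - (1 + x * harmonic n)) := by
  induction n with
  | zero => simpa [harmonicProd] using PadicDvd.zero
  | succ n ih =>
    have hi : PadicDvd p 0 (((n + 1 : ℕ) : ℚ)⁻¹) :=
      PadicDvd.inv_natCast (Nat.not_dvd_of_pos_of_lt (by omega) hn)
    have hxi := hx.mul_right hi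
    have hH := hx.mul_right (padicDvd_harmonic (p := p) (n := n) (by omega))
    have h := ((ih (by omega)).mul_right (PadicDvd.one.add (hxi.mono zero_le_one))).add (hH.mul hxi)
    rw [harmonicProd_succ, harmonic_succ]
    convert h using 1
    ring

lemma padicDvd_harmonicProd_sub_one (hx : PadicDvd p 1 x) {n : ℕ} (hn : n < p) :
    PadicDvd p 1 (harmonicProd x n - 1) := by
  have h := ((padicDvd_harmonicProd_sq hx hn).mono one_le_two).add
    (hx.mul_right (padicDvd_harmonic hn))
  convert h using 1
  ring

lemma padicDvd_harmonicProd {a : ℕ} {n : ℕ} (hn : n < 2 * p) :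
    PadicDvd p 1 (harmonicProd ((a * p : ℕ) : ℚ) n - (1 + (a * p : ℕ) * harmonic n)) ∧
      PadicDvd p 0 (harmonicProd ((a * p : ℕ) : ℚ) n) := by
  have hx : PadicDvd p 1 ((a * p : ℕ) : ℚ) := PadicDvd.natCast_of_dvd (Dvd.intro_left a rfl)
  have hp0 : (p : ℚ) ≠ 0 := by exact_mod_cast hp.out.ne_zero
  induction n with
  | zero =>
    simpa [harmonicProd] using And.intro (PadicDvd.zero (p := p) (m := 1)) PadicDvd.one
  | succ n ih =>
    obtain ⟨h1, h2⟩ := ih (by omega)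
    rw [harmonicProd_succ, harmonic_succ]
    by_cases hnp : n + 1 = p
    · have hq := padicDvd_harmonicProd_sub_one hx (n := n) (by omega)
      have hH := hx.mul_right (padicDvd_harmonic (p := p) (n := n) (by omega))
      have ha : ((a * p : ℕ) : ℚ) * ((n + 1 : ℕ) : ℚ)⁻¹ = a := by
        rw [hnp]
        push_cast
        field_simp
      have h0 := PadicDvd.one.add (PadicDvd.natCast (p := p) a)
      rw [ha]
      refine ⟨?_, h2.mul_right h0⟩
      convert (hq.mul_right h0).sub hH using 1
      linear_combination -ha
    · have hi : PadicDvd p 0 (((n + 1 : ℕ) : ℚ)⁻¹) := by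
        refine PadicDvd.inv_natCast ?_
        rintro ⟨c, hc⟩
        rcases c with _ | _ | c
        · omega
        · omega
        · nlinarith
      have hxi := hx.mul_right hi
      refine ⟨?_, h2.mul_right (PadicDvd.one.add (hxi.mono zero_le_one))⟩
      convert (h1.add (h2.mul_left hxi)).sub hxi using 1
      ring

lemma padicDvd_harmonic_pred (hp3 : 3 ≤ p) : PadicDvd p 1 (harmonic (p - 1)) := by
  have key : harmonic (p - 1) * 2 = ∑ i ∈ Finset.range (p - 1),
      (p : ℚ) * (((i + 1 : ℕ) : ℚ)⁻¹ * ((p - 1 - 1 - i + 1 : ℕ) : ℚ)⁻¹) := by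
    rw [mul_two, harmonic]
    nth_rewrite 2 [← Finset.sum_range_reflect]
    rw [← Finset.sum_add_distrib]
    refine Finset.sum_congr rfl fun i hi => ?_
    rw [Finset.mem_range] at hi
    have hs : (p : ℚ) = ((i + 1 : ℕ) : ℚ) + ((p - 1 - 1 - i + 1 : ℕ) : ℚ) := by
      rw [← Nat.cast_add]
      congr 1
      omega
    have h1 : ((i + 1 : ℕ) : ℚ) ≠ 0 := by positivity
    have h2 : ((p - 1 - 1 - i + 1 : ℕ) : ℚ) ≠ 0 := by positivity
    rw [hs]
    generalize ((i + 1 : ℕ) : ℚ) = r at *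
    generalize ((p - 1 - 1 - i + 1 : ℕ) : ℚ) = s at *
    field_simp
    ring
  have h2 : PadicDvd p 1 (harmonic (p - 1) * 2) := by
    rw [key]
    refine Finset.sum_induction _ _ (fun _ _ => PadicDvd.add) PadicDvd.zero fun i hi => ?_
    rw [Finset.mem_range] at hi
    exact PadicDvd.self.mul_right
      ((PadicDvd.inv_natCast (Nat.not_dvd_of_pos_of_lt (by omega) (by omega))).mul_right
      (PadicDvd.inv_natCast (Nat.not_dvd_of_pos_of_lt (by omega) (by omega))))
  have h3 := h2.mul_right (PadicDvd.inv_natCast (p := p) (a := 2)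
    (Nat.not_dvd_of_pos_of_lt (by omega) (by omega)))
  convert h3 using 1
  push_cast
  ring

lemma exists_factorial_mul_eq (hp3 : 3 ≤ p) (n : ℕ) : ∃ d : ℚ, PadicDvd p 2 (d - 1) ∧
    ((n * p).factorial : ℚ) = (p.factorial : ℚ) ^ n * n.factorial * d := by
  have hp0 : (p : ℚ) ≠ 0 := by exact_mod_cast hp.out.ne_zero
  induction n with
  | zero => exact ⟨1, by simpa using PadicDvd.zero, by simp⟩
  | succ n ih =>
    obtain ⟨d, hd, he⟩ := ih
    have hx : PadicDvd p 1 ((n * p : ℕ) : ℚ) := PadicDvd.natCast_of_dvd (Dvd.intro_left n rfl)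
    have hlt : p - 1 < p := by omega
    refine ⟨d * harmonicProd (n * p : ℕ) (p - 1), hd.mul_sub_one ?_, ?_⟩
    · have h := (padicDvd_harmonicProd_sq hx hlt).add (hx.mul (padicDvd_harmonic_pred hp3))
      convert h using 1
      ring
    · have hs : harmonicProd ((n * p : ℕ) : ℚ) p =
          harmonicProd (n * p : ℕ) (p - 1) * (1 + n) := by
        conv_lhs => rw [show p = p - 1 + 1 by omega, harmonicProd_succ]
        rw [show p - 1 + 1 = p by omega]
        push_cast
        field_simp
      rw [add_mul, one_mul, factorial_add_eq_harmonicProd, he, hs, Nat.factorial_succ]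
      push_cast
      ring

lemma cast_centralBinom_mul_factorial_sq (n : ℕ) :
    ((2 * n).choose n : ℚ) * (n.factorial : ℚ) ^ 2 = (2 * n).factorial := by
  have h := Nat.choose_mul_factorial_mul_factorial (n := 2 * n) (k := n) (by omega)
  rw [show 2 * n - n = n by omega] at h
  rw [← h]
  push_cast
  ring

lemma exists_centralBinom_mul_prime_eq (hp3 : 3 ≤ p) (k : ℕ) : ∃ d : ℚ, PadicDvd p 2 (d - 1) ∧
    ((2 * (k * p)).choose (k * p) : ℚ) = (2 * k).choose k * d := by
  obtain ⟨d, hd, he⟩ := exists_factorial_mul_eq hp3 k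
  obtain ⟨d', hd', he'⟩ := exists_factorial_mul_eq hp3 (2 * k)
  refine ⟨d' / (d * d), hd'.div_sub_one one_le_two (hd.mul_sub_one hd), ?_⟩
  have hd0 : d ≠ 0 := (hd.mono one_le_two).ne_zero
  have h1 := cast_centralBinom_mul_factorial_sq (k * p)
  have h2 := cast_centralBinom_mul_factorial_sq k
  rw [← mul_assoc, he', he, ← h2] at h1
  have hk : (k.factorial : ℚ) ≠ 0 := by exact_mod_cast k.factorial_ne_zero
  have hpf : (p.factorial : ℚ) ≠ 0 := by exact_mod_cast p.factorial_ne_zero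
  rw [← mul_assoc 2 k p]
  field_simp
  apply mul_right_cancel₀ (b := ((p.factorial : ℚ) ^ k * k.factorial) ^ 2) (by positivity)
  linear_combination h1

lemma centralBinom_add_mul_harmonicProd_sq (m j : ℕ) :
    ((2 * (m + j)).choose (m + j) : ℚ) * harmonicProd m j ^ 2 =
      (2 * m).choose m * (2 * j).choose j * harmonicProd (2 * m : ℕ) (2 * j) := by
  have h1 := cast_centralBinom_mul_factorial_sq (m + j)
  have h2 := cast_centralBinom_mul_factorial_sq m
  have h3 := cast_centralBinom_mul_factorial_sq j
  have h4 := factorial_add_eq_harmonicProd m j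
  have h5 := factorial_add_eq_harmonicProd (2 * m) (2 * j)
  rw [← mul_add] at h5
  rw [h5, h4, ← h2, ← h3] at h1
  have hm : (m.factorial : ℚ) ≠ 0 := by exact_mod_cast m.factorial_ne_zero
  have hj : (j.factorial : ℚ) ≠ 0 := by exact_mod_cast j.factorial_ne_zero
  apply mul_right_cancel₀ (b := ((m.factorial : ℚ) * j.factorial) ^ 2) (by positivity)
  linear_combination h1

lemma padicDvd_centralBinom_mul_harmonicProd_sub (k : ℕ) {j : ℕ} (hj : j < p) :
    PadicDvd p 2 (((2 * j).choose j : ℚ) * (harmonicProd (2 * (k * p) : ℕ) (2 * j) -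
      harmonicProd (k * p : ℕ) j ^ 2 *
        (1 + 2 * k * p * (harmonic (2 * j) - harmonic j)))) := by
  have hx : PadicDvd p 1 ((k * p : ℕ) : ℚ) := PadicDvd.natCast_of_dvd (Dvd.intro_left k rfl)
  have hx2 : PadicDvd p 1 ((2 * (k * p) : ℕ) : ℚ) :=
    PadicDvd.natCast_of_dvd (by rw [← mul_assoc]; exact Dvd.intro_left _ rfl)
  have ha := hx.mul_right (padicDvd_harmonic hj)
  set Q := harmonicProd (k * p : ℕ) j
  have hQ1 : PadicDvd p 1 (Q - 1) := padicDvd_harmonicProd_sub_one hx hj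
  have hQ := hQ1.of_sub_one
  by_cases hlt : 2 * j < p
  · refine (PadicDvd.natCast _).mul_left ?_
    have e1 := padicDvd_harmonicProd_sq hx2 hlt
    have e2 : PadicDvd p 2 (Q - _) := padicDvd_harmonicProd_sq hx hj
    have hb := hx.mul_right (padicDvd_harmonic hlt)
    set P := harmonicProd (2 * (k * p) : ℕ) (2 * j)
    have hc := PadicDvd.two.mul_left (hb.sub ha)
    have hF := PadicDvd.one.add (hc.mono zero_le_one)
    have ha0 := ha.mono zero_le_one
    have h := ((e1.sub ((e2.mul_right (hQ.add (PadicDvd.one.add ha0))).mul_right hF)).sub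
      (PadicDvd.two.mul_left (ha.mul hc))).sub ((ha.mul ha).mul_right hF)
    convert h using 1
    push_cast
    ring
  · have hdvd : p ∣ (2 * j).choose j :=
      hp.out.dvd_choose hj (by omega) (by omega)
    refine PadicDvd.mul (m := 1) (n := 1) (PadicDvd.natCast_of_dvd hdvd) ?_
    obtain ⟨e1, e0⟩ := padicDvd_harmonicProd (p := p) (a := 2 * k) (n := 2 * j) (by omega)
    rw [mul_assoc 2 k p] at e1 e0
    set P := harmonicProd (2 * (k * p) : ℕ) (2 * j)
    have hQ2 := hQ1.mul_sub_one hQ1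
    have h := (e1.sub (hQ2.mul_right (e0.sub (e1.mono zero_le_one)))).add
      ((hQ.mul_left hQ).mul_left (PadicDvd.two.mul_left ha))
    convert h using 1
    push_cast
    ring

end

theorem central_binom_shift_congr (p : ℕ) (hp : p.Prime) (hp5 : 5 ≤ p) (k : ℕ)
    (j : ℕ) (hj1 : 1 ≤ j) (hj2 : j ≤ p - 1) :
    padicNorm p
        (((2 * k * p + 2 * j).choose (k * p + j) : ℚ) -
          ((2 * k).choose k : ℚ) * ((2 * j).choose j) *
            (1 + 2 * k * p * (harmonic (2 * j) - harmonic j))) ≤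
      (p : ℚ) ^ (-(2 : ℤ)) := by
  have : Fact p.Prime := ⟨hp⟩
  have hj : j < p := by omega
  obtain ⟨d, hd, he⟩ := exists_centralBinom_mul_prime_eq (p := p) (by omega) k
  have hx : PadicDvd p 1 ((k * p : ℕ) : ℚ) := PadicDvd.natCast_of_dvd (Dvd.intro_left k rfl)
  have hQ := padicDvd_harmonicProd_sub_one hx hj
  have hmain := padicDvd_centralBinom_mul_harmonicProd_sub (p := p) k hj
  have hprod := centralBinom_add_mul_harmonicProd_sq (k * p) j
  obtain ⟨-, hP⟩ := padicDvd_harmonicProd (p := p) (a := 2 * k) (n := 2 * j) (by omega)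
  rw [mul_assoc 2 k p] at hP
  rw [show 2 * k * p + 2 * j = 2 * (k * p + j) by ring]
  change PadicDvd p 2 _
  refine PadicDvd.of_mul_right (hQ.mul_sub_one hQ) ?_
  have h := (PadicDvd.natCast ((2 * k).choose k)).mul_left
    (hmain.add (hd.mul_right ((PadicDvd.natCast ((2 * j).choose j)).mul_left hP)))
  convert h using 1
  rw [he] at hprod
  linear_combination hprod
end

section
/- Let $p \ge 5$ be a prime and $j$ an integer with $1 \le j \le \frac{p-1}{2}$. Then $\binom{p}{j}^2 \binom{2p}{2j}^{-1} \equiv -\frac{p}{j} \pmod{p^2}$ (as a congruence of rational numbers, i.e. the $p$-adic valuation of $\binom{p}{j}^2/\binom{2p}{2j} + p/j$ is at least $2$). -/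
/-- If a prime `p` divides `N + 1`, then `N.choose k ≡ (-1) ^ k` modulo `p` for `k < p`. -/
theorem cast_choose_eq_neg_one_pow_of_prime_dvd_succ {p N k : ℕ} (hp : p.Prime)
    (hN : p ∣ N + 1) (hk : k < p) : (N.choose k : ZMod p) = (-1) ^ k := by
  induction k with
  | zero => simp
  | succ k ih =>
    have hdvd : p ∣ (N + 1).choose (k + 1) := by
      have h : p ∣ (N + 1).choose (k + 1) * (k + 1) := by
        rw [← Nat.add_one_mul_choose_eq]
        exact hN.mul_right _
      exact (hp.dvd_mul.mp h).resolve_right (Nat.not_dvd_of_pos_of_lt k.succ_pos hk)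
    have hsum := (ZMod.natCast_eq_zero_iff _ _).mpr hdvd
    rw [Nat.choose_succ_succ', Nat.cast_add, ih (by omega)] at hsum
    rw [pow_succ]
    linear_combination hsum

theorem choose_sq_div_choose_congr_first_half (p : ℕ) (hp : p.Prime) (hp5 : 5 ≤ p)
    (j : ℕ) (hj1 : 1 ≤ j) (hj2 : j ≤ (p - 1) / 2) :
    padicNorm p ((p.choose j : ℚ) ^ 2 / ((2 * p).choose (2 * j)) - (-((p : ℚ) / j))) ≤
      (p : ℚ) ^ (-(2 : ℤ)) := by
  have : Fact p.Prime := ⟨hp⟩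
  obtain ⟨i, rfl⟩ : ∃ i, j = i + 1 := ⟨j - 1, by omega⟩
  obtain ⟨q, rfl⟩ : ∃ q, p = q + 1 := ⟨p - 1, by omega⟩
  set a := q.choose i
  set d := (2 * q + 1).choose (2 * i + 1)
  have ha : (a : ZMod (q + 1)) = (-1) ^ i :=
    cast_choose_eq_neg_one_pow_of_prime_dvd_succ hp dvd_rfl (by omega)
  have hd : (d : ZMod (q + 1)) = (-1) ^ (2 * i + 1) :=
    cast_choose_eq_neg_one_pow_of_prime_dvd_succ hp ⟨2, by ring⟩ (by omega)
  replace hd : (d : ZMod (q + 1)) = -1 := by simpa [pow_succ, pow_mul] using hd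
  obtain ⟨m, hm⟩ : q + 1 ∣ a ^ 2 + d := by
    rw [← ZMod.natCast_eq_zero_iff]
    push_cast
    rw [ha, hd, ← pow_mul, mul_comm i, pow_mul]
    simp
  have hpd : ¬ q + 1 ∣ d := by
    rw [← ZMod.natCast_eq_zero_iff, hd]
    simp
  have hpj : ¬ q + 1 ∣ i + 1 := Nat.not_dvd_of_pos_of_lt i.succ_pos (by omega)
  have hd0 : (d : ℚ) ≠ 0 := by
    rintro h
    exact hpd (by simp [Nat.cast_eq_zero.mp h])
  have hi0 : ((i + 1 : ℕ) : ℚ) ≠ 0 := by positivity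
  have hq0 : ((q + 1 : ℕ) : ℚ) ≠ 0 := by positivity
  have hA : ((q + 1).choose (i + 1) : ℚ) = (q + 1 : ℕ) * a / (i + 1 : ℕ) := by
    rw [eq_div_iff hi0]
    exact_mod_cast (Nat.add_one_mul_choose_eq q i).symm
  have hD : ((2 * (q + 1)).choose (2 * (i + 1)) : ℚ) = (q + 1 : ℕ) * d / (i + 1 : ℕ) := by
    rw [eq_div_iff hi0]
    have h : (2 * q + 1 + 1) * d = (2 * q + 1 + 1).choose (2 * i + 1 + 1) * (2 * i + 1 + 1) :=
      Nat.add_one_mul_choose_eq _ _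
    have h' : (2 * (q + 1)).choose (2 * (i + 1)) * (i + 1) = (q + 1) * d := by
      rw [show 2 * (q + 1) = 2 * q + 1 + 1 by ring, show 2 * (i + 1) = 2 * i + 1 + 1 by ring]
      linarith
    exact_mod_cast h'
  have hmQ : (a : ℚ) ^ 2 + d = (q + 1 : ℕ) * m := by exact_mod_cast hm
  have key : ((q + 1).choose (i + 1) : ℚ) ^ 2 / ((2 * (q + 1)).choose (2 * (i + 1))) -
      (-(((q + 1 : ℕ) : ℚ) / (i + 1 : ℕ))) =
      ((q + 1 : ℕ) : ℚ) ^ 2 * m / ((i + 1 : ℕ) * d) := by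
    rw [hA, hD]
    field_simp
    linear_combination hmQ
  rw [key, padicNorm.div, padicNorm.mul, padicNorm.mul, (padicNorm.nat_eq_one_iff _).mpr hpd,
    (padicNorm.nat_eq_one_iff _).mpr hpj, pow_two, padicNorm.mul,
    padicNorm.padicNorm_p_of_prime, mul_one, div_one, zpow_neg, zpow_ofNat, pow_two, mul_inv]
  exact mul_le_of_le_one_right (by positivity) (padicNorm.of_nat _)
end

section
/- Let $p \ge 5$ be a prime and $j$ an integer with $\frac{p+1}{2} \le j \le p-1$. Then $\binom{p}{j}^2 \binom{2p}{2j}^{-1} \equiv \frac{p}{j} \pmod{p^2}$ (as a congruence of rational numbers, i.e. the $p$-adic valuation of $\binom{p}{j}^2/\binom{2p}{2j} - p/j$ is at least $2$). -/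
theorem Nat.Prime.cast_choose_pred_eq_neg_one_pow {p : ℕ} (hp : p.Prime) {k : ℕ} (hk : k < p) :
    ((p - 1).choose k : ZMod p) = (-1) ^ k := by
  induction k with
  | zero => simp
  | succ k ih =>
    have pascal : p.choose (k + 1) = (p - 1).choose k + (p - 1).choose (k + 1) := by
      conv_lhs => rw [← Nat.sub_add_cancel hp.one_le]
      exact Nat.choose_succ_succ' _ _
    have h : (p.choose (k + 1) : ZMod p) = 0 :=
      (ZMod.natCast_eq_zero_iff _ _).2 (hp.dvd_choose_self k.succ_ne_zero hk)
    rw [pascal, Nat.cast_add, ih (by omega)] at h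
    rw [pow_succ]
    linear_combination h

theorem Nat.Prime.cast_choose_two_mul_pred_eq_neg_one_pow {p : ℕ} (hp : p.Prime) {k : ℕ}
    (hk : k < p) : ((2 * p - 1).choose (p + k) : ZMod p) = (-1) ^ k := by
  have := Fact.mk hp
  have lucas := Choose.choose_modEq_choose_mod_mul_choose_div_nat
    (p := p) (n := 2 * p - 1) (k := p + k)
  have hn : 2 * p - 1 = (p - 1) + p := by omega
  have hlt : p - 1 < p := Nat.sub_lt hp.pos one_pos
  rw [hn, Nat.add_mod_right, Nat.add_mod_left, Nat.add_div_right _ hp.pos,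
    Nat.add_div_left _ hp.pos, Nat.mod_eq_of_lt hlt, Nat.mod_eq_of_lt hk,
    Nat.div_eq_of_lt hlt, Nat.div_eq_of_lt hk, Nat.choose_self, mul_one, ← hn] at lucas
  rw [(ZMod.natCast_eq_natCast_iff _ _ _).2 lucas, hp.cast_choose_pred_eq_neg_one_pow hk]

theorem choose_sq_div_choose_congr_second_half (p : ℕ) (hp : p.Prime) (hp5 : 5 ≤ p)
    (j : ℕ) (hj1 : (p + 1) / 2 ≤ j) (hj2 : j ≤ p - 1) :
    padicNorm p ((p.choose j : ℚ) ^ 2 / ((2 * p).choose (2 * j)) - (p : ℚ) / j) ≤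
      (p : ℚ) ^ (-(2 : ℤ)) := by
  have := Fact.mk hp
  have hodd : p % 2 = 1 := hp.eq_two_or_odd.resolve_left (by omega)
  set A := (p - 1).choose (j - 1) with hA
  set B := (2 * p - 1).choose (2 * j - 1) with hB
  have hAj : p * A = p.choose j * j := by
    have := Nat.add_one_mul_choose_eq (p - 1) (j - 1)
    rwa [Nat.sub_add_cancel (by omega), Nat.sub_add_cancel (by omega)] at this
  have hBj : p * B = (2 * p).choose (2 * j) * j := by
    have := Nat.add_one_mul_choose_eq (2 * p - 1) (2 * j - 1)
    rw [Nat.sub_add_cancel (by omega), Nat.sub_add_cancel (by omega)] at this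
    linarith
  have hA1 : (A : ZMod p) ^ 2 = 1 := by
    rw [hA, hp.cast_choose_pred_eq_neg_one_pow (by omega), ← pow_mul, mul_comm, pow_mul]
    simp
  have hB1 : (B : ZMod p) = 1 := by
    rw [hB, show 2 * j - 1 = p + (2 * j - 1 - p) by omega,
      hp.cast_choose_two_mul_pred_eq_neg_one_pow (by omega)]
    exact Even.neg_one_pow (Nat.even_iff.2 (by omega))
  obtain ⟨c, hc⟩ : (p : ℤ) ∣ (A : ℤ) ^ 2 - B := by
    rw [← ZMod.intCast_zmod_eq_zero_iff_dvd]
    simp [hA1, hB1]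
  have hpB : ¬ p ∣ B := by
    rw [← ZMod.natCast_eq_zero_iff, hB1]
    exact one_ne_zero
  have hpj : ¬ p ∣ j := Nat.not_dvd_of_pos_of_lt (by omega) (by omega)
  have hp0 : (p : ℚ) ≠ 0 := mod_cast hp.ne_zero
  have hj0 : (j : ℚ) ≠ 0 := by
    have : j ≠ 0 := by omega
    exact_mod_cast this
  have hB0 : (B : ℚ) ≠ 0 := by
    have : B ≠ 0 := by rintro h; simp [h] at hpB
    exact_mod_cast this
  have hA' : (p.choose j : ℚ) = p * A / j := by
    rw [eq_div_iff hj0]; exact_mod_cast hAj.symm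
  have hB' : ((2 * p).choose (2 * j) : ℚ) = p * B / j := by
    rw [eq_div_iff hj0]; exact_mod_cast hBj.symm
  have hc' : (A : ℚ) ^ 2 - B = p * c := mod_cast hc
  have key : (p.choose j : ℚ) ^ 2 / ((2 * p).choose (2 * j)) - (p : ℚ) / j =
      p * p * c / (j * B) := by
    rw [hA', hB']
    field_simp
    linear_combination hc'
  rw [key, padicNorm.div, padicNorm.mul, padicNorm.mul, padicNorm.mul,
    padicNorm.padicNorm_p_of_prime, (padicNorm.nat_eq_one_iff j).2 hpj,
    (padicNorm.nat_eq_one_iff B).2 hpB, mul_one, div_one, zpow_neg, zpow_ofNat, pow_two, mul_inv]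
  exact mul_le_of_le_one_right (by positivity) (padicNorm.of_int c)
end

section
/- Let $p \ge 5$ be a prime, $n, k \in \mathbb{N}$ with $n > k$, and $j$ an integer with $1 \le j \le p-1$. Then $\binom{np}{kp+j}^2 \equiv \frac{(n-k)^2 p^2}{j^2} \binom{n}{k}^2 \pmod{p^3}$ (as a congruence of rational numbers, i.e. the $p$-adic valuation of the difference is at least $3$). -/
/-- Modulo a prime `p`, the entries of row `p - 1` of Pascal's triangle are `± 1`. -/
theorem choose_prime_sub_one_sq_eq_one {p : ℕ} [Fact p.Prime] {i : ℕ} (hi : i < p) :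
    (((p - 1).choose i : ℕ) : ZMod p) ^ 2 = 1 := by
  induction i with
  | zero => simp
  | succ i ih =>
    have hp := Fact.out (p := p.Prime)
    have h : (((p - 1).choose i + (p - 1).choose (i + 1) : ℕ) : ZMod p) = 0 := by
      rw [← Nat.choose_succ_succ', Nat.sub_add_cancel hp.one_le,
        ZMod.natCast_eq_zero_iff]
      exact hp.dvd_choose_self (Nat.succ_ne_zero i) hi
    push_cast at h
    rw [eq_neg_of_add_eq_zero_right h, neg_sq, ih (by omega)]

/-- The prime `p` divides `(n * p).choose (k * p + j)`, and the quotient is determined up to sign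
modulo `p`. -/
theorem exists_choose_mul_prime_eq {p : ℕ} [Fact p.Prime] (n k j : ℕ) (hkn : k < n)
    (hj1 : 1 ≤ j) (hjp : j < p) :
    ∃ a : ℕ, (n * p).choose (k * p + j) = p * a ∧
      (j : ZMod p) ^ 2 * (a : ZMod p) ^ 2 =
        (((n - k) * n.choose k : ℕ) : ZMod p) ^ 2 := by
  have hp := Fact.out (p := p.Prime)
  obtain ⟨m, rfl⟩ : ∃ m, n = m + 1 := ⟨n - 1, by omega⟩
  obtain ⟨i, rfl⟩ : ∃ i, j = i + 1 := ⟨j - 1, by omega⟩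
  have hrow : (m + 1) * p = m * p + (p - 1) + 1 := by
    have := hp.one_le
    rw [add_mul]; omega
  have habs : (m + 1) * p * (m * p + (p - 1)).choose (k * p + i) =
      ((m + 1) * p).choose (k * p + (i + 1)) * (k * p + (i + 1)) := by
    have := Nat.add_one_mul_choose_eq (m * p + (p - 1)) (k * p + i)
    rwa [← hrow] at this
  have hdvd : p ∣ ((m + 1) * p).choose (k * p + (i + 1)) := by
    refine (hp.dvd_mul.1 (habs ▸ ⟨(m + 1) * (m * p + (p - 1)).choose (k * p + i), by ring⟩ :
      p ∣ _ * (k * p + (i + 1)))).resolve_right fun h => ?_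
    exact Nat.not_dvd_of_pos_of_lt hj1 hjp ((Nat.dvd_add_right (Dvd.intro_left k rfl)).1 h)
  obtain ⟨a, ha⟩ := hdvd
  refine ⟨a, ha, ?_⟩
  have hquot : (m + 1) * (m * p + (p - 1)).choose (k * p + i) = a * (k * p + (i + 1)) := by
    rw [ha] at habs
    exact Nat.eq_of_mul_eq_mul_left hp.pos (by linarith)
  have hlucas : (((m * p + (p - 1)).choose (k * p + i) : ℕ) : ZMod p) =
      (((p - 1).choose i * m.choose k : ℕ) : ZMod p) := by
    rw [ZMod.natCast_eq_natCast_iff]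
    have h := Choose.choose_modEq_choose_mod_mul_choose_div_nat
      (p := p) (n := m * p + (p - 1)) (k := k * p + i)
    have hi : i < p := by omega
    have hp1 : p - 1 < p := Nat.sub_lt hp.pos one_pos
    rwa [mul_comm m, mul_comm k, Nat.mul_add_mod, Nat.mul_add_mod, Nat.mod_eq_of_lt hp1,
      Nat.mod_eq_of_lt hi, Nat.mul_add_div hp.pos, Nat.mul_add_div hp.pos, Nat.div_eq_of_lt hp1,
      Nat.div_eq_of_lt hi, add_zero, add_zero, mul_comm p m, mul_comm p k] at h
  have hsmall : (m + 1 - k) * (m + 1).choose k = (m + 1) * m.choose k := by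
    rw [mul_comm, ← Nat.choose_mul_succ_eq, mul_comm]
  have hcast := congrArg (Nat.cast : ℕ → ZMod p) hquot
  rw [Nat.cast_mul, hlucas] at hcast
  push_cast at hcast
  simp only [CharP.cast_eq_zero, mul_zero, zero_add] at hcast
  rw [hsmall]
  push_cast
  rw [← mul_pow, mul_comm, ← hcast, mul_pow, mul_pow,
    choose_prime_sub_one_sq_eq_one (by omega), mul_pow, one_mul]

theorem choose_np_sq_congr (p : ℕ) (hp : p.Prime) (hp5 : 5 ≤ p) (n k : ℕ) (hkn : k < n)
    (j : ℕ) (hj1 : 1 ≤ j) (hj2 : j ≤ p - 1) :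
    padicNorm p
        (((n * p).choose (k * p + j) : ℚ) ^ 2 -
          ((n - k : ℕ) : ℚ) ^ 2 * (p : ℚ) ^ 2 / (j : ℚ) ^ 2 * (n.choose k : ℚ) ^ 2) ≤
      (p : ℚ) ^ (-(3 : ℤ)) := by
  have : Fact p.Prime := ⟨hp⟩
  have hjp : j < p := by omega
  obtain ⟨a, ha, hmod⟩ := exists_choose_mul_prime_eq n k j hkn hj1 hjp
  have hj0 : (j : ℚ) ≠ 0 := by positivity
  have hnorm : padicNorm p (j : ℚ) = 1 :=
    (padicNorm.nat_eq_one_iff j).2 (Nat.not_dvd_of_pos_of_lt hj1 hjp)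
  have hdvd : ((p ^ 3 : ℕ) : ℤ) ∣
      (p : ℤ) ^ 2 * ((j : ℤ) ^ 2 * (a : ℤ) ^ 2 - (((n - k) * n.choose k : ℕ) : ℤ) ^ 2) := by
    rw [Nat.cast_pow, pow_succ]
    refine mul_dvd_mul_left _ ((ZMod.intCast_zmod_eq_zero_iff_dvd _ p).1 ?_)
    push_cast at hmod ⊢
    rw [hmod, sub_self]
  have hle := padicNorm.dvd_iff_norm_le.1 hdvd
  rw [ha]
  have heq : ((p * a : ℕ) : ℚ) ^ 2 -
      ((n - k : ℕ) : ℚ) ^ 2 * (p : ℚ) ^ 2 / (j : ℚ) ^ 2 * (n.choose k : ℚ) ^ 2 =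
      (((p : ℤ) ^ 2 * ((j : ℤ) ^ 2 * (a : ℤ) ^ 2 -
        (((n - k) * n.choose k : ℕ) : ℤ) ^ 2) : ℤ) : ℚ) / ((j : ℚ) * j) := by
    push_cast
    field_simp
  rw [heq, padicNorm.div, padicNorm.mul (q := (j : ℚ)), hnorm, mul_one, div_one]
  exact_mod_cast hle
end

section
/- Let $p \ge 5$ be a prime and $n$ a positive integer. Then $\sum_{k=0}^{n-1}\sum_{j=1}^{p-1} \binom{np}{kp+j}^2 \binom{2kp+2j}{kp+j}\binom{2np-2kp-2j}{np-kp-j} \equiv 8 p^3 B_{p-3} \sum_{k=0}^{n-1}\binom{n}{k}^2\binom{2k}{k}\binom{2n-2k-2}{n-k-1} n (n-k)^2 \pmod{p^4}$ (as a congruence of rational numbers, i.e. the $p$-adic valuation of the difference is at least $4$). -/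
open Finset

theorem natCast_ne_zero_of_pos_of_lt {p j : ℕ} (hj : 0 < j) (hjp : j < p) :
    (j : ZMod p) ≠ 0 := fun h =>
  Nat.not_dvd_of_pos_of_lt hj hjp ((ZMod.natCast_eq_zero_iff j p).1 h)

theorem choose_mul_add_cast {p : ℕ} [Fact p.Prime] {a b : ℕ} (A B : ℕ) (ha : a < p) (hb : b < p) :
    ((A * p + a).choose (B * p + b) : ZMod p) = a.choose b * A.choose B := by
  have hp : 0 < p := by omega
  have h := (ZMod.natCast_eq_natCast_iff _ _ _).2
    (Choose.choose_modEq_choose_mod_mul_choose_div_nat (n := A * p + a) (k := B * p + b) (p := p))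
  have e : ∀ x y, y < p → (x * p + y) % p = y ∧ (x * p + y) / p = x := fun x y hy => by
    refine ⟨by rw [mul_comm, Nat.mul_add_mod, Nat.mod_eq_of_lt hy], ?_⟩
    rw [mul_comm, Nat.mul_add_div hp, Nat.div_eq_of_lt hy, add_zero]
  rw [(e A a ha).1, (e A a ha).2, (e B b hb).1, (e B b hb).2] at h
  rw [h, Nat.cast_mul]

theorem choose_sub_cast {p : ℕ} [Fact p.Prime] {a t : ℕ} (ha : 0 < a) (hat : a + t ≤ p) :
    ((p - a).choose t : ZMod p) = (-1) ^ t * (a + t - 1).choose t := by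
  have ht : (t.factorial : ZMod p) ≠ 0 := fun h => by
    rw [ZMod.natCast_eq_zero_iff, (Fact.out : p.Prime).dvd_factorial] at h
    omega
  refine mul_left_cancel₀ ht ?_
  rw [← Nat.cast_mul, ← Nat.descFactorial_eq_factorial_mul_choose, mul_left_comm, ← Nat.cast_mul,
    ← Nat.ascFactorial_eq_factorial_mul_choose', Nat.descFactorial_eq_prod_range,
    Nat.ascFactorial_eq_prod_range, Nat.cast_prod, Nat.cast_prod]
  conv_rhs => rw [← Finset.card_range t, ← Finset.prod_const, Finset.card_range,
    ← Finset.prod_mul_distrib]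
  refine Finset.prod_congr rfl fun i hi => ?_
  have hi := Finset.mem_range.1 hi
  rw [Nat.sub_sub, Nat.cast_sub (by omega)]
  simp

theorem exists_choose_mul_eq {p : ℕ} [Fact p.Prime] {n k j : ℕ} (hk : k < n) (hj : 0 < j)
    (hjp : j < p) :
    ∃ u : ℕ, (n * p).choose (k * p + j) = p * u ∧
      (u * j : ZMod p) = (-1) ^ (j - 1) * ((n - k : ℕ) * n.choose k) := by
  obtain ⟨n, rfl⟩ := Nat.exists_eq_add_one.2 (by omega : 0 < n)
  obtain ⟨i, rfl⟩ := Nat.exists_eq_add_one.2 hj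
  have hp : p.Prime := Fact.out
  have h := Nat.add_one_mul_choose_eq (n * p + (p - 1)) (k * p + i)
  have e : n * p + (p - 1) + 1 = (n + 1) * p := by rw [add_mul]; have := hp.pos; omega
  rw [e, add_assoc] at h
  have hcop : Nat.Coprime p (k * p + (i + 1)) := by
    rw [hp.coprime_iff_not_dvd, Nat.dvd_add_right (Dvd.intro_left _ rfl)]
    exact Nat.not_dvd_of_pos_of_lt hj hjp
  obtain ⟨u, hu⟩ := hcop.dvd_of_dvd_mul_right
    (h ▸ Dvd.dvd.mul_right (Dvd.intro_left _ rfl) _ :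
      p ∣ ((n + 1) * p).choose (k * p + (i + 1)) * (k * p + (i + 1)))
  refine ⟨u, hu, ?_⟩
  have h2 : (n + 1) * (n * p + (p - 1)).choose (k * p + i) = u * (k * p + (i + 1)) := by
    refine Nat.eq_of_mul_eq_mul_left hp.pos ?_
    rw [hu] at h
    linarith
  have h3 := congrArg (Nat.cast (R := ZMod p)) h2
  push_cast at h3
  rw [choose_mul_add_cast n k (by omega) (by omega), choose_sub_cast one_pos (by omega)] at h3
  have h4 := congrArg (Nat.cast (R := ZMod p)) (Nat.choose_mul_succ_eq n k)
  push_cast at h4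
  simp at h3
  push_cast
  linear_combination -h3 + (-1) ^ i * h4

theorem exists_centralBinom_eq {p : ℕ} [Fact p.Prime] {j : ℕ} (m : ℕ) (hj : 0 < j)
    (hjp : 2 * j < p) :
    ∃ v : ℕ, (2 * (m * p + (p - j))).choose (m * p + (p - j)) = p * v ∧
      (v * j * (2 * j).choose j : ZMod p) = -2 * ((2 * m + 1) * (2 * m).choose m) := by
  have hp : p.Prime := Fact.out
  obtain ⟨u, hu, hu'⟩ := exists_choose_mul_eq (p := p) (n := 2 * m + 1) (k := m) (j := j)
    (by omega) hj (by omega)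
  set r := p - 2 * j with hr
  have h := Nat.choose_mul (n := (2 * m + 1) * p + r) (k := m * p + (p - j)) (s := r)
    (by omega)
  have e1 : m * p + (p - j) - r = m * p + j := by omega
  have e2 : 2 * (m * p + (p - j)) = (2 * m + 1) * p + r := by
    have : (2 * m + 1) * p = 2 * (m * p) + p := by ring
    omega
  rw [e1, Nat.add_sub_cancel, hu] at h
  have c1 : ((m * p + (p - j)).choose r : ZMod p) = (p - j).choose j := by
    have := choose_mul_add_cast (p := p) (a := p - j) (b := r) m 0 (by omega) (by omega)
    rw [zero_mul, zero_add] at this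
    rw [this, Nat.choose_zero_right, Nat.cast_one, mul_one,
      Nat.choose_symm_of_eq_add (by omega : p - j = r + j)]
  have c2 : (((2 * m + 1) * p + r).choose r : ZMod p) = 1 := by
    have := choose_mul_add_cast (p := p) (a := r) (b := r) (2 * m + 1) 0 (by omega) (by omega)
    rw [zero_mul, zero_add] at this
    simpa using this
  have c3 := choose_sub_cast (p := p) (a := j) (t := j) hj (by omega)
  have c4 : (2 * j).choose j = 2 * (j + j - 1).choose j := by
    obtain ⟨i, rfl⟩ := Nat.exists_eq_add_one.2 hj
    rw [show 2 * (i + 1) = (2 * i + 1) + 1 by ring, Nat.choose_succ_succ,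
      show i + 1 + (i + 1) - 1 = 2 * i + 1 by omega,
      Nat.choose_symm_of_eq_add (by omega : 2 * i + 1 = i + (i + 1))]
    ring
  have c5 : (2 * m + 1 - m) * (2 * m + 1).choose m = (2 * m + 1) * (2 * m).choose m := by
    rw [mul_comm, ← Nat.choose_mul_succ_eq, mul_comm]
  have hndvd : ¬ p ∣ (m * p + (p - j)).choose r := by
    rw [← ZMod.natCast_eq_zero_iff, c1, ZMod.natCast_eq_zero_iff]
    intro hd
    have hf := Nat.choose_mul_factorial_mul_factorial (by omega : j ≤ p - j)
    have := (hp.dvd_factorial (n := p - j)).1 (hf ▸ (hd.mul_right _).mul_right _)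
    omega
  obtain ⟨v, hv⟩ := (hp.dvd_mul.1
    (h ▸ (dvd_mul_right p u).mul_left _ : p ∣ ((2 * m + 1) * p + r).choose (m * p + (p - j)) *
      (m * p + (p - j)).choose r)).resolve_right hndvd
  refine ⟨v, by rw [e2, hv], ?_⟩
  have h2 : v * (m * p + (p - j)).choose r = ((2 * m + 1) * p + r).choose r * u := by
    refine Nat.eq_of_mul_eq_mul_left hp.pos ?_
    rw [hv] at h
    linarith
  have h3 := congrArg (Nat.cast (R := ZMod p)) h2
  rw [Nat.cast_mul, Nat.cast_mul, c1, c2, c3, one_mul] at h3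
  rw [← Nat.cast_mul (2 * m + 1 - m), c5] at hu'
  rw [c4]
  obtain ⟨i, rfl⟩ := Nat.exists_eq_add_one.2 hj
  have hs : ((-1 : ZMod p) ^ i) * (-1) ^ i = 1 := by rw [← mul_pow]; simp
  simp only [Nat.add_sub_cancel, pow_succ] at hu' h3
  push_cast at hu' h3 ⊢
  rw [← h3] at hu'
  set X := ((i + 1 + (i + 1) - 1).choose (i + 1) : ZMod p)
  linear_combination (-2 * (-1) ^ i) * hu' +
    (-2 * v * (i + 1) * X - 2 * (2 * m + 1) * (2 * m).choose m) * hs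

theorem padicNorm_bernoulli_le_one {p : ℕ} [Fact p.Prime] (m : ℕ) (hm : m + 1 < p) :
    padicNorm p (bernoulli m) ≤ 1 := by
  induction m using Nat.strong_induction_on with
  | _ m ih =>
    have h := sum_bernoulli (m + 1)
    rw [sum_range_succ, Nat.choose_succ_self_right] at h
    have h1 : padicNorm p ((m + 1 : ℕ) : ℚ) = 1 :=
      (padicNorm.nat_eq_one_iff _).2 (Nat.not_dvd_of_pos_of_lt m.succ_pos hm)
    have h2 : padicNorm p (((m + 1 : ℕ) : ℚ) * bernoulli m) ≤ 1 := by
      rw [← eq_sub_iff_add_eq'] at h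
      rw [h]
      refine padicNorm.sub.trans (max_le ?_ (padicNorm.sum_le' (fun i hi => ?_) zero_le_one))
      · split_ifs <;> simp
      · have hi := mem_range.1 hi
        rw [padicNorm.mul]
        exact mul_le_one₀ (padicNorm.of_nat _) (padicNorm.nonneg _) (ih i hi (by omega))
    rwa [padicNorm.mul, h1, one_mul] at h2

theorem not_dvd_den_of_padicNorm_le_one {p : ℕ} [Fact p.Prime] {x : ℚ} (hx : padicNorm p x ≤ 1) :
    ¬ p ∣ x.den := by
  intro hd
  have hn : padicNorm p (x.num : ℚ) = 1 := by
    refine (padicNorm.int_eq_one_iff _).2 fun hn => ?_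
    have := Nat.dvd_gcd (Int.natCast_dvd.1 hn) hd
    rw [x.reduced.gcd_eq_one, Nat.dvd_one] at this
    exact (Fact.out : p.Prime).ne_one this
  rw [← Rat.mul_den_eq_num, padicNorm.mul] at hn
  have := (padicNorm.nat_lt_one_iff _).2 hd
  have h0 := padicNorm.nonneg (p := p) (x.den : ℚ)
  nlinarith

/-- A `p`-integral rational that is `p`-adically close to a natural number has the same residue. -/
theorem natCast_eq_ratCast_of_padicNorm_lt_one {p : ℕ} [Fact p.Prime] {x : ℚ} {m : ℕ}
    (hx : padicNorm p x ≤ 1) (h : padicNorm p (m - x) < 1) : (m : ZMod p) = (x : ZMod p) := by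
  have hd := not_dvd_den_of_padicNorm_le_one hx
  have hd' : (x.den : ZMod p) ≠ 0 := by rwa [Ne, ZMod.natCast_eq_zero_iff]
  rw [Rat.cast_def, eq_div_iff hd', ← sub_eq_zero]
  have e : (((m * x.den - x.num : ℤ)) : ℚ) = (m - x) * x.den := by
    push_cast
    rw [sub_mul, Rat.mul_den_eq_num]
  have h2 : padicNorm p (((m * x.den - x.num : ℤ)) : ℚ) < 1 := by
    rw [e, padicNorm.mul, (padicNorm.nat_eq_one_iff _).2 hd, mul_one]
    exact h
  rw [padicNorm.int_lt_one_iff, ← ZMod.intCast_zmod_eq_zero_iff_dvd] at h2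
  exact_mod_cast h2

theorem exists_sum_pow_eq_mul {p : ℕ} [Fact p.Prime] {e : ℕ} (he : e + 2 < p) (he2 : 0 < e) :
    ∃ τ : ℕ, ∑ j ∈ range p, j ^ e = p * τ ∧ (τ : ZMod p) = (bernoulli e : ZMod p) := by
  have hp : p.Prime := Fact.out
  have hp0 : (p : ℚ) ≠ 0 := by exact_mod_cast hp.ne_zero
  have he1 : (e : ℚ) + 1 ≠ 0 := by positivity
  set w : ℚ := ∑ i ∈ range e, bernoulli i * ((e + 1).choose i) * (p : ℚ) ^ (e - 1 - i) / (e + 1)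
    with hw
  have hfaul : ((∑ j ∈ range p, j ^ e : ℕ) : ℚ) = p * (bernoulli e + p * w) := by
    push_cast
    rw [sum_range_pow, sum_range_succ, hw, mul_add, ← mul_assoc, mul_sum, add_comm]
    congr 1
    · rw [Nat.choose_succ_self_right, show e + 1 - e = 1 by omega]
      push_cast
      field_simp
    · refine sum_congr rfl fun i hi => ?_
      have hi := mem_range.1 hi
      rw [show e + 1 - i = e - 1 - i + 2 by omega, pow_add]
      ring
  have hwn : padicNorm p w ≤ 1 := by
    refine padicNorm.sum_le' (fun i hi => ?_) zero_le_one
    have hi := mem_range.1 hi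
    have h1 : padicNorm p ((e : ℚ) + 1) = 1 := by
      have := (padicNorm.nat_eq_one_iff (p := p) (e + 1)).2
        (Nat.not_dvd_of_pos_of_lt e.succ_pos (by omega))
      exact_mod_cast this
    rw [padicNorm.div, h1, div_one, padicNorm.mul, padicNorm.mul]
    refine mul_le_one₀ (mul_le_one₀ (padicNorm_bernoulli_le_one i (by omega))
      (padicNorm.nonneg _) (padicNorm.of_nat _)) (padicNorm.nonneg _) ?_
    exact_mod_cast padicNorm.of_nat (p := p) (p ^ (e - 1 - i))
  have hB := padicNorm_bernoulli_le_one (p := p) e (by omega)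
  have hplt := padicNorm.padicNorm_p_lt_one hp.one_lt
  have hpw : padicNorm p (p * w) < 1 := by
    rw [padicNorm.mul]
    exact mul_lt_one_of_nonneg_of_lt_one_left (padicNorm.nonneg _) hplt hwn
  have hdvd : p ∣ ∑ j ∈ range p, j ^ e := by
    rw [← padicNorm.nat_lt_one_iff, hfaul, padicNorm.mul]
    exact mul_lt_one_of_nonneg_of_lt_one_left (padicNorm.nonneg _) hplt
      (padicNorm.nonarchimedean.trans (max_le hB hpw.le))
  obtain ⟨τ, hτ⟩ := hdvd
  refine ⟨τ, hτ, natCast_eq_ratCast_of_padicNorm_lt_one hB ?_⟩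
  rw [hτ, Nat.cast_mul] at hfaul
  rw [mul_left_cancel₀ hp0 hfaul, add_sub_cancel_left]
  exact hpw

theorem sum_Icc_one_eq_sum_range {M : Type*} [AddCommMonoid M] (f : ℕ → M) (N : ℕ) :
    ∑ j ∈ Icc 1 N, f j = ∑ j ∈ range N, f (j + 1) := by
  rw [range_eq_Ico, sum_Ico_add' f 0 N 1]
  rfl

theorem sum_Icc_reflect_pair {M : Type*} [AddCommMonoid M] (f : ℕ → M) (h : ℕ) :
    ∑ j ∈ Icc 1 (2 * h), f j = ∑ j ∈ Icc 1 h, (f j + f (2 * h + 1 - j)) := by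
  rw [sum_Icc_one_eq_sum_range, sum_Icc_one_eq_sum_range, two_mul, sum_range_add, sum_add_distrib]
  congr 1
  rw [← sum_range_reflect]
  refine sum_congr rfl fun i hi => congrArg f ?_
  have := mem_range.1 hi
  omega

theorem sum_Icc_even_odd_pair {M : Type*} [AddCommMonoid M] (f : ℕ → M) (h : ℕ) :
    ∑ j ∈ Icc 1 (2 * h), f j = ∑ j ∈ Icc 1 h, (f (2 * j) + f (2 * h + 1 - 2 * j)) := by
  have e2 : ∀ N, ∑ j ∈ range (2 * N), f (j + 1) =
      ∑ j ∈ range N, f (2 * j + 2) + ∑ j ∈ range N, f (2 * j + 1) := fun N => by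
    induction N with
    | zero => simp
    | succ N ih =>
      rw [mul_add_one, sum_range_succ, sum_range_succ, ih, sum_range_succ, sum_range_succ]
      abel
  rw [sum_Icc_one_eq_sum_range, sum_Icc_one_eq_sum_range, e2, sum_add_distrib]
  congr 1
  rw [← sum_range_reflect]
  refine sum_congr rfl fun i hi => congrArg f ?_
  have := mem_range.1 hi
  omega

theorem exists_sub_pow_eq {e : ℕ} (he : Even e) (p x : ℤ) :
    ∃ z, (p - x) ^ e = x ^ e - e * p * x ^ (e - 1) + p ^ 2 * z := by
  obtain ⟨z, hz⟩ := Polynomial.powAddExpansion x (-p) e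
  refine ⟨z, ?_⟩
  rw [← he.neg_pow, neg_sub, sub_eq_add_neg, hz]
  ring

/-- `∑_{j < p/2} j ^ (p - 4) ≡ -2 B_{p-3} (mod p)`. -/
theorem sum_half_pow_eq {h : ℕ} [hp : Fact (2 * h + 1).Prime] (hh : 2 ≤ h) :
    ∑ j ∈ Icc 1 h, (j : ZMod (2 * h + 1)) ^ (2 * h - 3) =
      -2 * (bernoulli (2 * h - 2) : ZMod (2 * h + 1)) := by
  obtain ⟨g, rfl⟩ := Nat.exists_eq_add_of_le' hh
  set p := 2 * (g + 2) + 1 with hp_def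
  set e := 2 * (g + 2) - 2 with he_def
  have he : Even e := ⟨g + 1, by omega⟩
  obtain ⟨τ, hτ, hτB⟩ := exists_sum_pow_eq_mul (p := p) (e := e) (by omega) (by omega)
  have hT : ∑ j ∈ Icc 1 (2 * (g + 2)), (j : ℤ) ^ e = p * τ := by
    rw [← Nat.cast_mul, ← hτ, hp_def, sum_range_succ', zero_pow (by omega), add_zero,
      range_eq_Ico, sum_Ico_add' (fun j => j ^ e) 0 _ 1]
    push_cast
    rfl
  choose z hz using exists_sub_pow_eq he (p : ℤ)
  set U : ℤ := ∑ j ∈ Icc 1 (g + 2), (j : ℤ) ^ e with hU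
  set S : ℤ := ∑ j ∈ Icc 1 (g + 2), (j : ℤ) ^ (e - 1) with hS
  have h1 : (p * τ : ℤ) = 2 * U - e * p * S + p ^ 2 * ∑ j ∈ Icc 1 (g + 2), z j := by
    rw [← hT, sum_Icc_reflect_pair, hU, hS, mul_sum, mul_sum, mul_sum, ← sum_sub_distrib,
      ← sum_add_distrib]
    refine sum_congr rfl fun j hj => ?_
    have := mem_Icc.1 hj
    rw [Nat.cast_sub (by omega), ← hp_def, hz]
    ring
  have h2 : (p * τ : ℤ) = 2 * 2 ^ e * U - e * p * (2 ^ (e - 1) * S) +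
      p ^ 2 * ∑ j ∈ Icc 1 (g + 2), z (2 * j) := by
    rw [← hT, sum_Icc_even_odd_pair, hU, hS, mul_sum, mul_sum, mul_sum, mul_sum,
      ← sum_sub_distrib, ← sum_add_distrib]
    refine sum_congr rfl fun j hj => ?_
    have := mem_Icc.1 hj
    rw [Nat.cast_sub (by omega), ← hp_def]
    push_cast
    rw [hz, mul_pow, mul_pow]
    ring
  set Z1 := ∑ j ∈ Icc 1 (g + 2), z j
  set Z2 := ∑ j ∈ Icc 1 (g + 2), z (2 * j)
  have e1 : (2 : ℤ) ^ e = 2 * 2 ^ (e - 1) := by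
    rw [← pow_succ', show e - 1 + 1 = e by omega]
  have hp0 : (p : ℤ) ≠ 0 := by positivity
  have h3 : (2 ^ e - 1) * τ = - e * 2 ^ (e - 1) * S + p * (2 ^ e * Z1 - Z2) := by
    refine mul_left_cancel₀ hp0 ?_
    rw [e1] at h2 ⊢
    linear_combination 2 * 2 ^ (e - 1) * h1 - h2
  have h4 := congrArg (Int.cast (R := ZMod p)) h3
  push_cast at h4
  have hS' : (S : ZMod p) = ∑ j ∈ Icc 1 (g + 2), (j : ZMod p) ^ (2 * (g + 2) - 3) := by
    rw [hS]; push_cast; rfl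
  have two0 : (2 : ZMod p) ≠ 0 := by
    have := natCast_ne_zero_of_pos_of_lt (p := p) (j := 2) (by omega) (by omega)
    exact_mod_cast this
  have three0 : (3 : ZMod p) ≠ 0 := by
    have := natCast_ne_zero_of_pos_of_lt (p := p) (j := 3) (by omega) (by omega)
    exact_mod_cast this
  have hflt := ZMod.pow_card_sub_one_eq_one two0
  have e4 : (2 : ZMod p) ^ (p - 1) = 2 ^ (e - 1) * 8 := by
    rw [show p - 1 = e - 1 + 3 by omega, pow_add]; norm_num
  rw [e4] at hflt
  have ee : (e : ZMod p) = -3 := by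
    have : ((e + 3 : ℕ) : ZMod p) = 0 := by
      rw [show e + 3 = p by omega]; exact ZMod.natCast_self p
    push_cast at this
    linear_combination this
  have e1' : (2 : ZMod p) ^ e = 2 * 2 ^ (e - 1) := by
    exact_mod_cast congrArg (Int.cast (R := ZMod p)) e1
  rw [ee, e1', ZMod.natCast_self, zero_mul, add_zero] at h4
  rw [← hτB, ← hS']
  refine mul_left_cancel₀ three0 ?_
  linear_combination -8 * h4 + (2 * τ - 3 * S) * hflt

theorem exists_sum_eq_mul {ι : Type*} {p q : ℕ} (s : Finset ι) (f : ι → ℕ) (g : ι → ZMod p)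
    (h : ∀ i ∈ s, ∃ t : ℕ, f i = q * t ∧ (t : ZMod p) = g i) :
    ∃ t : ℕ, ∑ i ∈ s, f i = q * t ∧ (t : ZMod p) = ∑ i ∈ s, g i := by
  choose! t ht ht' using h
  refine ⟨∑ i ∈ s, t i, ?_, ?_⟩
  · rw [mul_sum, sum_congr rfl ht]
  · rw [Nat.cast_sum, sum_congr rfl ht']

/-- The sum of the two terms with indices `k * p + j` and `k * p + (p - j)`, where `j < p / 2`. -/
theorem exists_domb_pair_eq {p : ℕ} [Fact p.Prime] {n k j : ℕ} (hk : k < n) (hj : 0 < j)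
    (hjp : 2 * j < p) :
    ∃ t : ℕ,
      (n * p).choose (k * p + j) ^ 2 * (2 * k * p + 2 * j).choose (k * p + j) *
          (2 * n * p - 2 * k * p - 2 * j).choose (n * p - k * p - j) +
        (n * p).choose (k * p + (p - j)) ^ 2 *
          (2 * k * p + 2 * (p - j)).choose (k * p + (p - j)) *
          (2 * n * p - 2 * k * p - 2 * (p - j)).choose (n * p - k * p - (p - j)) = p ^ 3 * t ∧
      (t : ZMod p) = -4 * ((n.choose k ^ 2 * (2 * k).choose k *
        (2 * n - 2 * k - 2).choose (n - k - 1) * n * (n - k) ^ 2 : ℕ) : ZMod p) *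
          (j ^ 3 : ZMod p)⁻¹ := by
  obtain ⟨m, rfl⟩ := Nat.exists_eq_add_of_lt hk
  have hj0 := natCast_ne_zero_of_pos_of_lt hj (by omega : j < p)
  obtain ⟨u, hu, hu'⟩ := exists_choose_mul_eq (p := p) hk hj (by omega)
  obtain ⟨w, hw, hw'⟩ := exists_choose_mul_eq (p := p) (j := p - j) hk (by omega) (by omega)
  obtain ⟨v, hv, hv'⟩ := exists_centralBinom_eq (p := p) m hj hjp
  obtain ⟨x, hx, hx'⟩ := exists_centralBinom_eq (p := p) k hj hjp
  have e : (k + m + 1) * p = k * p + (m * p + p) := by ring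
  have i1 : (k + m + 1) * p - k * p - j = m * p + (p - j) := by omega
  have i2 : 2 * (k + m + 1) * p - 2 * k * p - 2 * j = 2 * (m * p + (p - j)) := by
    rw [mul_assoc, mul_assoc, e]; omega
  have i3 : (k + m + 1) * p - k * p - (p - j) = m * p + j := by omega
  have i4 : 2 * (k + m + 1) * p - 2 * k * p - 2 * (p - j) = 2 * m * p + 2 * j := by
    rw [mul_assoc, mul_assoc, mul_assoc, e]; omega
  have i5 : 2 * k * p + 2 * (p - j) = 2 * (k * p + (p - j)) := by ring
  have i6 : 2 * (k + m + 1) - 2 * k - 2 = 2 * m := by omega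
  have i7 : k + m + 1 - k - 1 = m := by omega
  have i8 : k + m + 1 - k = m + 1 := by omega
  rw [i8] at hu' hw'
  rw [i1, i2, i3, i4, i5, i6, i7, i8, hu, hv, hw, hx]
  refine ⟨u ^ 2 * (2 * k * p + 2 * j).choose (k * p + j) * v +
    w ^ 2 * x * (2 * m * p + 2 * j).choose (m * p + j), by ring, ?_⟩
  have c1 := choose_mul_add_cast (p := p) (a := 2 * j) (b := j) (2 * k) k (by omega) (by omega)
  have c2 := choose_mul_add_cast (p := p) (a := 2 * j) (b := j) (2 * m) m (by omega) (by omega)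
  have hs : ∀ i : ℕ, ((-1 : ZMod p) ^ i) ^ 2 = 1 := fun i => by
    rw [← pow_mul, mul_comm, pow_mul]; simp
  have su := congrArg (· ^ 2) hu'
  have sw := congrArg (· ^ 2) hw'
  rw [mul_pow (_ ^ _), hs, one_mul] at su sw
  rw [Nat.cast_sub (by omega : j ≤ p), ZMod.natCast_self, zero_sub] at sw
  rw [eq_mul_inv_iff_mul_eq₀ (pow_ne_zero 3 hj0)]
  push_cast at su sw ⊢
  rw [c1, c2]
  set C := ((k + m + 1).choose k : ZMod p)
  set J := ((2 * j).choose j : ZMod p)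
  set K := ((2 * k).choose k : ZMod p)
  set M := ((2 * m).choose m : ZMod p)
  linear_combination (K * (v * j * J)) * su + (M * (x * j * J)) * sw
    + ((m + 1) * C) ^ 2 * K * hv' + ((m + 1) * C) ^ 2 * M * hx'

theorem exists_double_sum_eq {p : ℕ} [Fact p.Prime] (hp5 : 5 ≤ p) (n : ℕ) :
    ∃ t : ℕ, ∑ k ∈ range n, ∑ j ∈ Icc 1 (p - 1),
        (n * p).choose (k * p + j) ^ 2 * (2 * k * p + 2 * j).choose (k * p + j) *
          (2 * n * p - 2 * k * p - 2 * j).choose (n * p - k * p - j) = p ^ 3 * t ∧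
      (t : ZMod p) = 8 * (bernoulli (p - 3) : ZMod p) *
        ((∑ k ∈ range n, n.choose k ^ 2 * (2 * k).choose k *
          (2 * n - 2 * k - 2).choose (n - k - 1) * n * (n - k) ^ 2 : ℕ) : ZMod p) := by
  have hp : p.Prime := Fact.out
  obtain ⟨h, rfl⟩ : ∃ h, p = 2 * h + 1 := hp.odd_of_ne_two (by omega)
  rw [Nat.cast_sum, mul_sum]
  refine exists_sum_eq_mul _ _ _ fun k hk => ?_
  rw [Nat.add_sub_cancel, sum_Icc_reflect_pair]
  obtain ⟨t, ht, ht'⟩ := exists_sum_eq_mul (Icc 1 h) _ _ fun j hj =>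
    exists_domb_pair_eq (p := 2 * h + 1) (n := n) (k := k) (j := j) (mem_range.1 hk)
      (mem_Icc.1 hj).1 (by have := mem_Icc.1 hj; omega)
  refine ⟨t, ht, ?_⟩
  rw [ht', ← mul_sum]
  have hinv : ∑ j ∈ Icc 1 h, ((j : ZMod (2 * h + 1)) ^ 3)⁻¹ =
      ∑ j ∈ Icc 1 h, (j : ZMod (2 * h + 1)) ^ (2 * h - 3) := by
    refine sum_congr rfl fun j hj => ?_
    have hj := mem_Icc.1 hj
    have hj0 := natCast_ne_zero_of_pos_of_lt hj.1 (by omega : j < 2 * h + 1)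
    rw [inv_eq_iff_eq_inv, ← mul_eq_one_iff_eq_inv₀ (pow_ne_zero _ hj0), ← pow_add,
      show 3 + (2 * h - 3) = 2 * h + 1 - 1 by omega, ZMod.pow_card_sub_one_eq_one hj0]
  rw [hinv, sum_half_pow_eq (by omega), show 2 * h + 1 - 3 = 2 * h - 2 by omega]
  ring

/-- A natural number with the same residue as `x * r` differs from it by a multiple of `p`. -/
theorem padicNorm_sub_mul_le {p : ℕ} [Fact p.Prime] {x : ℚ} {t r : ℕ} (hx : padicNorm p x ≤ 1)
    (h : (t : ZMod p) = (x : ZMod p) * r) : padicNorm p (t - x * r) ≤ (p : ℚ) ^ (-(1 : ℤ)) := by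
  have hd := not_dvd_den_of_padicNorm_le_one hx
  have hd' : (x.den : ZMod p) ≠ 0 := by rwa [Ne, ZMod.natCast_eq_zero_iff]
  have h1 : ((p ^ 1 : ℕ) : ℤ) ∣ t * x.den - x.num * r := by
    rw [pow_one, ← ZMod.intCast_zmod_eq_zero_iff_dvd]
    push_cast
    rw [h, Rat.cast_def]
    field_simp
    ring
  rw [padicNorm.dvd_iff_norm_le] at h1
  have e : ((t * x.den - x.num * r : ℤ) : ℚ) = (t - x * r) * x.den := by
    push_cast
    rw [← Rat.mul_den_eq_num]
    ring
  rw [e, padicNorm.mul, (padicNorm.nat_eq_one_iff _).2 hd, mul_one] at h1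
  exact_mod_cast h1

theorem double_sum_domb_congr (p : ℕ) (hp : p.Prime) (hp5 : 5 ≤ p) (n : ℕ) (hn : 0 < n) :
    padicNorm p
        ((∑ k ∈ range n, ∑ j ∈ Icc 1 (p - 1),
            ((n * p).choose (k * p + j) : ℚ) ^ 2 *
              ((2 * k * p + 2 * j).choose (k * p + j)) *
                ((2 * n * p - 2 * k * p - 2 * j).choose (n * p - k * p - j))) -
          8 * (p : ℚ) ^ 3 * bernoulli (p - 3) *
            ∑ k ∈ range n,
              (n.choose k : ℚ) ^ 2 * ((2 * k).choose k) * ((2 * n - 2 * k - 2).choose (n - k - 1)) *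
                n * ((n - k : ℕ) : ℚ) ^ 2) ≤
      (p : ℚ) ^ (-(4 : ℤ)) := by
  have := Fact.mk hp
  obtain ⟨t, ht, ht'⟩ := exists_double_sum_eq hp5 n
  set R := ∑ k ∈ range n, n.choose k ^ 2 * (2 * k).choose k *
    (2 * n - 2 * k - 2).choose (n - k - 1) * n * (n - k) ^ 2 with hR
  have hB := padicNorm_bernoulli_le_one (p := p) (p - 3) (by omega)
  have key := padicNorm_sub_mul_le (t := t) (r := 8 * R) hB (by rw [ht']; push_cast; ring)
  have hL := congrArg (Nat.cast (R := ℚ)) ht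
  have hRQ := congrArg (Nat.cast (R := ℚ)) hR
  push_cast at hL hRQ key
  rw [hL, ← hRQ, show (p : ℚ) ^ 3 * t - 8 * p ^ 3 * bernoulli (p - 3) * R =
    p ^ 3 * (t - bernoulli (p - 3) * (8 * R)) by ring, padicNorm.mul]
  have hp0 : (p : ℚ) ≠ 0 := by exact_mod_cast hp.ne_zero
  have h3 : padicNorm p ((p : ℚ) ^ 3) = (p : ℚ) ^ (-(3 : ℤ)) := by
    simp only [pow_succ, pow_zero, one_mul, padicNorm.mul, padicNorm.padicNorm_p hp.one_lt]
    rw [zpow_neg]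
    norm_cast
    field_simp
    exact Nat.cast_pow p 3
  rw [h3, show (-(4 : ℤ)) = -3 + -1 by norm_num, zpow_add₀ hp0]
  exact mul_le_mul_of_nonneg_left key (by positivity)
end

section
/- Let $p \ge 5$ be a prime and $n$ a positive integer. Then $\sum_{k=0}^{n}\binom{np}{kp}^2 \binom{2kp}{kp} \equiv \sum_{k=0}^{n}\binom{n}{k}^2\binom{2k}{k} \pmod{p^3}$ (as a congruence of integers). -/
open Finset

open Polynomial in
/-- The polynomial `(X + 1) ⋯ (X + (p - 1))` is `X ^ (p - 1) - 1` modulo `p`. -/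
theorem prod_X_add_succ_zmod (p : ℕ) [hp : Fact p.Prime] :
    ∏ j ∈ range (p - 1), (X + C ((j : ZMod p) + 1)) = X ^ (p - 1) - 1 := by
  have hpos : 0 < p - 1 := Nat.sub_pos_of_lt hp.out.one_lt
  have hmonic : (∏ j ∈ range (p - 1), (X + C ((j : ZMod p) + 1))).Monic :=
    monic_prod_of_monic _ _ fun _ _ => monic_X_add_C _
  have hdeg : (∏ j ∈ range (p - 1), (X + C ((j : ZMod p) + 1))).degree = ((p - 1 : ℕ) : WithBot ℕ) := by
    rw [degree_prod]
    simp only [degree_X_add_C]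
    simp
  have hcast : ∀ i ∈ range (p - 1), (i : ZMod p) + 1 ≠ 0 := by
    intro i hi h
    have hdvd : p ∣ i + 1 := (ZMod.natCast_eq_zero_iff _ _).1 (by exact_mod_cast h)
    have := Nat.le_of_dvd i.succ_pos hdvd
    have := mem_range.1 hi
    omega
  refine eq_of_degree_sub_lt_of_eval_index_eq (s := range (p - 1))
    (v := fun i : ℕ => -((i : ZMod p) + 1)) ?_ ?_ ?_
  · intro i hi j hj hij
    have hi' := mem_range.1 (mem_coe.1 hi)
    have hj' := mem_range.1 (mem_coe.1 hj)
    have h : (i : ZMod p) = j := by simpa using hij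
    rw [ZMod.natCast_eq_natCast_iff'] at h
    rwa [Nat.mod_eq_of_lt (by omega), Nat.mod_eq_of_lt (by omega)] at h
  · have hdeg' : (X ^ (p - 1) - 1 : (ZMod p)[X]).degree = ((p - 1 : ℕ) : WithBot ℕ) := by
      simpa using degree_X_pow_sub_C hpos (1 : ZMod p)
    have hmonic' : (X ^ (p - 1) - 1 : (ZMod p)[X]).Monic := by
      simpa using monic_X_pow_sub_C (1 : ZMod p) hpos.ne'
    rw [card_range, ← hdeg]
    exact degree_sub_lt_left (hdeg.trans hdeg'.symm) hmonic.ne_zero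
      (by rw [hmonic.leadingCoeff, hmonic'.leadingCoeff])
  · intro i hi
    rw [eval_prod, prod_eq_zero hi (by simp)]
    rw [eval_sub, eval_pow, eval_X, eval_one,
      ZMod.pow_card_sub_one_eq_one (neg_ne_zero.2 (hcast i hi)), sub_self]

open Polynomial in
/-- Modulo `p ^ 3`, the product `(x + 1) ⋯ (x + (p - 1))` takes the same value at every
multiple `x` of `p`. -/
theorem prod_mul_add_succ_modEq {p : ℕ} (hp : p.Prime) (hp5 : 5 ≤ p) (i : ℤ) :
    ∏ j ∈ range (p - 1), (i * p + (j + 1)) ≡ (p - 1).factorial [ZMOD (p : ℤ) ^ 3] := by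
  have := Fact.mk hp
  set P : ℤ[X] := ∏ j ∈ range (p - 1), (X + C ((j : ℤ) + 1)) with hP
  have heval (x : ℤ) : P.eval x = ∏ j ∈ range (p - 1), (x + (j + 1)) := by
    simp [hP, eval_prod]
  have hmap : P.map (Int.castRingHom (ZMod p)) = X ^ (p - 1) - 1 := by
    rw [← prod_X_add_succ_zmod, hP, Polynomial.map_prod]
    simp
  have hcoeff (k : ℕ) (hk0 : k ≠ 0) (hk : k < p - 1) : (p : ℤ) ∣ P.coeff k := by
    rw [← ZMod.intCast_zmod_eq_zero_iff_dvd, ← eq_intCast (Int.castRingHom (ZMod p)), ← coeff_map, hmap]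
    simp [coeff_X_pow, coeff_one, hk.ne, hk0]
  have hexpand (x : ℤ) : P.eval x =
      P.coeff 0 + P.coeff 1 * x + P.coeff 2 * x ^ 2 + P.divX.divX.divX.eval x * x ^ 3 := by
    conv_lhs => rw [← divX_mul_X_add P, ← divX_mul_X_add P.divX, ← divX_mul_X_add P.divX.divX]
    simp only [eval_add, eval_mul, eval_X, eval_C, coeff_divX]
    ring
  have hzero : P.eval 0 = (p - 1).factorial := by
    rw [heval, ← prod_range_add_one_eq_factorial]
    push_cast
    simp
  have hcoeff_zero : P.coeff 0 = (p - 1).factorial := by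
    rw [coeff_zero_eq_eval_zero, hzero]
  have hsymm : P.eval (-p : ℤ) = P.coeff 0 := by
    have heven : Even (p - 1) := hp.even_sub_one (by omega)
    rw [coeff_zero_eq_eval_zero, heval, heval, ← prod_range_reflect]
    calc ∏ j ∈ range (p - 1), (-(p : ℤ) + (((p - 1 - 1 - j : ℕ) : ℤ) + 1))
        = ∏ j ∈ range (p - 1), (-1 * (0 + ((j : ℤ) + 1))) := by
          refine prod_congr rfl fun j hj => ?_
          have := mem_range.1 hj
          omega
      _ = _ := by rw [prod_mul_distrib, prod_const, card_range, heven.neg_one_pow, one_mul]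
  obtain ⟨b, hb⟩ := hcoeff 2 (by omega) (by omega)
  have hp0 : (p : ℤ) ≠ 0 := by exact_mod_cast hp.ne_zero
  have hone : P.coeff 1 = p ^ 2 * (b - P.divX.divX.divX.eval (-p : ℤ)) := by
    rw [hexpand, hb] at hsymm
    apply mul_right_cancel₀ hp0
    linear_combination -hsymm
  rw [← heval, hexpand, hone, hb, hcoeff_zero]
  refine (Int.modEq_iff_dvd.2 ⟨(b - P.divX.divX.divX.eval (-p : ℤ)) * i + b * i ^ 2
    + P.divX.divX.divX.eval (i * p) * i ^ 3, ?_⟩).symm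
  ring

theorem factorial_mul_eq_factorial_mul_pow_mul_prod {p : ℕ} (hp : 0 < p) (m : ℕ) :
    (m * p).factorial =
      m.factorial * p ^ m * ∏ i ∈ range m, ∏ j ∈ range (p - 1), (i * p + (j + 1)) := by
  induction m with
  | zero => simp
  | succ m ih =>
    obtain ⟨q, rfl⟩ : ∃ q, p = q + 1 := ⟨p - 1, by omega⟩
    rw [prod_range_succ, Nat.add_mul, one_mul, ← Nat.factorial_mul_ascFactorial, ih,
      Nat.ascFactorial_eq_prod_range, prod_range_succ, Nat.factorial_succ, Nat.add_sub_cancel]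
    have : ∀ j, m * (q + 1) + 1 + j = m * (q + 1) + (j + 1) := fun j => by ring
    simp only [this]
    ring

/-- **Ljunggren's congruence**: `(np choose kp) ≡ (n choose k)` modulo `p ^ 3` for primes
`p ≥ 5`. -/
theorem choose_mul_mul_modEq_choose {p : ℕ} (hp : p.Prime) (hp5 : 5 ≤ p) {n k : ℕ} (hk : k ≤ n) :
    ((n * p).choose (k * p) : ℤ) ≡ n.choose k [ZMOD (p : ℤ) ^ 3] := by
  obtain ⟨l, rfl⟩ := Nat.exists_eq_add_of_le hk
  set Q : ℕ → ℕ := fun m => ∏ i ∈ range m, ∏ j ∈ range (p - 1), (i * p + (j + 1))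
  have hfac (m : ℕ) : (m * p).factorial = m.factorial * p ^ m * Q m :=
    factorial_mul_eq_factorial_mul_pow_mul_prod hp.pos m
  have hQ (m : ℕ) : (Q m : ℤ) ≡ ((p - 1).factorial : ℤ) ^ m [ZMOD (p : ℤ) ^ 3] := by
    have := Int.ModEq.prod (s := range m) fun i _ => prod_mul_add_succ_modEq hp hp5 (i : ℤ)
    simpa [Q] using this
  have hmul : ((k + l) * p).choose (k * p) * (Q k * Q l) = (k + l).choose k * Q (k + l) := by
    have h := Nat.add_choose_mul_factorial_mul_factorial (k * p) (l * p)
    have h' := Nat.add_choose_mul_factorial_mul_factorial k l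
    rw [← Nat.choose_symm_add] at h h'
    rw [← Nat.add_mul, hfac, hfac, hfac, ← h'] at h
    have hpos : 0 < k.factorial * l.factorial * p ^ (k + l) := by
      have := hp.pos
      positivity
    apply Nat.eq_of_mul_eq_mul_right hpos
    linear_combination h
  have hcop : Int.gcd ((p : ℤ) ^ 3) (((p - 1).factorial : ℤ) ^ (k + l)) = 1 := by
    have : Nat.Coprime p (p - 1).factorial :=
      hp.coprime_factorial_of_lt (Nat.sub_one_lt hp.ne_zero)
    exact_mod_cast this.pow 3 (k + l)
  have hcongr : ((k + l) * p).choose (k * p) * ((p - 1).factorial : ℤ) ^ (k + l) ≡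
      (k + l).choose k * ((p - 1).factorial : ℤ) ^ (k + l) [ZMOD (p : ℤ) ^ 3] :=
    calc (((k + l) * p).choose (k * p) : ℤ) * ((p - 1).factorial : ℤ) ^ (k + l)
        ≡ ((k + l) * p).choose (k * p) * (Q k * Q l) [ZMOD (p : ℤ) ^ 3] := by
          rw [pow_add]
          exact (((hQ k).mul (hQ l)).mul_left _).symm
      _ = (k + l).choose k * Q (k + l) := by exact_mod_cast hmul
      _ ≡ _ [ZMOD (p : ℤ) ^ 3] := (hQ (k + l)).mul_left _
  simpa [hcop] using hcongr.cancel_right_div_gcd (by have := hp.pos; positivity)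

theorem sum_choose_sq_central_binom_congr (p : ℕ) (hp : p.Prime) (hp5 : 5 ≤ p)
    (n : ℕ) (hn : 0 < n) :
    (∑ k ∈ range (n + 1), ((n * p).choose (k * p) : ℤ) ^ 2 * ((2 * k * p).choose (k * p))) ≡
      (∑ k ∈ range (n + 1), (n.choose k : ℤ) ^ 2 * ((2 * k).choose k)) [ZMOD (p : ℤ) ^ 3] := by
  refine Int.ModEq.sum fun k hk => ?_
  have hkn : k ≤ n := Nat.lt_succ_iff.1 (mem_range.1 hk)
  exact ((choose_mul_mul_modEq_choose hp hp5 hkn).pow 2).mul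
    (choose_mul_mul_modEq_choose hp hp5 (by omega))
end
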